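/- arXiv:1703.02493 — 11 statements merged into one kernel-verified Lean document; each statement's English description precedes it below -/
import Mathlib

section
/- Let f : ℝ^m → ℝ^n be a polynomial map of degree d admitting a decoupled representation f(u) = Σ_{k=1}^r w_k g_k(v_k^T u) with g_k(t) = c_{k,1} t + ⋯ + c_{k,d} t^d. Then the coefficient tensor Q ∈ ℝ^{n×m×δ} of f admits the CP decomposition Q = Σ_{k=1}^r w_k ∘ v_k ∘ z_k, where z_k = [c_{k,1} | c_{k,2} v_k^T | c_{k,3} (v_k⊗v_k)^T | ⋯ | c_{k,d} (v_k⊗⋯⊗v_k)^T]^T ∈ ℝ^δ and ∘ denotes the outer product. -/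
open scoped BigOperators

/-- Index set of size `δ = Σ_{k=1}^d m^{k-1}`: the block of degree `(s:ℕ)+1` (for `s : Fin d`)
is indexed by tuples of length `s`. -/
abbrev DeltaIdx (m d : ℕ) : Type := Σ s : Fin d, (Fin (s : ℕ) → Fin m)

/-- A tensor of order `s` and dimension `m` (indexed by tuples) is symmetric if its entries
are invariant under all permutations of the indices. -/
def SymT {m s : ℕ} (T : (Fin s → Fin m) → ℝ) : Prop :=
  ∀ (σ : Equiv.Perm (Fin s)) (α : Fin s → Fin m), T (α ∘ σ) = T α

/-- The polynomial map `ℝ^m → ℝ^n` of degree `d` (zero constant term) determined by the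
symmetric tensors `Φ i s` of the degree-`(s+1)` homogeneous parts of its components. -/
def polyEval {m n d : ℕ}
    (Φ : (i : Fin n) → (s : Fin d) → (Fin ((s : ℕ) + 1) → Fin m) → ℝ)
    (u : Fin m → ℝ) (i : Fin n) : ℝ :=
  ∑ s : Fin d, ∑ α : Fin ((s : ℕ) + 1) → Fin m, Φ i s α * ∏ t, u (α t)

/-- The coefficient tensor `Q ∈ ℝ^{n×m×δ}`, with slices `Q_{i,:,:} = Ψ(f_i)` given by
first-mode unfoldings of the symmetric tensors of `f_i`. -/
def coeffTensor {m n d : ℕ}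
    (Φ : (i : Fin n) → (s : Fin d) → (Fin ((s : ℕ) + 1) → Fin m) → ℝ) :
    Fin n → Fin m → DeltaIdx m d → ℝ :=
  fun i j p => Φ i p.1 (Fin.cons j p.2)

/-- The Jacobian tensor `J ∈ ℝ^{n×m×N}` of `f` at sampling points `pts`:
`J i j l = ∂f_i/∂u_j (pts l)`. -/
noncomputable def jacTensor {m n N : ℕ} (f : (Fin m → ℝ) → Fin n → ℝ)
    (pts : Fin N → Fin m → ℝ) : Fin n → Fin m → Fin N → ℝ :=
  fun i j l => fderiv ℝ (fun x => f x i) (pts l) (Pi.single j 1)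

/-- The Vandermonde-like matrix `A ∈ ℝ^{δ×N}`: in the block of degree `(s:ℕ)+1`, the `j`-th
column equals `((s:ℕ)+1)` times the `s`-fold Kronecker power of the sampling point. -/
def vdm (m d N : ℕ) (pts : Fin N → Fin m → ℝ) : Matrix (DeltaIdx m d) (Fin N) ℝ :=
  Matrix.of fun p j => ((p.1 : ℕ) + 1 : ℝ) * ∏ i, pts j (p.2 i)

/-- The structured vector `z = [c_1 | c_2 v^T | c_3 (v⊗v)^T | ⋯ ]^T ∈ ℝ^δ`. -/
def zVec {m : ℕ} (d : ℕ) (c : Fin d → ℝ) (v : Fin m → ℝ) : DeltaIdx m d → ℝ :=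
  fun p => c p.1 * ∏ i, v (p.2 i)

/-- `T = Σ_{k=1}^r a_k ∘ b_k ∘ c_k` is a CP decomposition with `r` terms. -/
def IsCPDecomp {I J K : Type*} (r : ℕ) (T : I → J → K → ℝ)
    (a : Fin r → I → ℝ) (b : Fin r → J → ℝ) (c : Fin r → K → ℝ) : Prop :=
  ∀ i j k, T i j k = ∑ l, a l i * b l j * c l k

/-- The CP rank of a third-order tensor. -/
noncomputable def cpRank {I J K : Type*} (T : I → J → K → ℝ) : ℕ :=
  sInf {r | ∃ a b c, IsCPDecomp r T a b c}

/-- Essential uniqueness of the CP decomposition with `r` terms: any two decompositions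
coincide up to permutation of the terms and scalings with product `1` within each term. -/
def EssUnique {I J K : Type*} (r : ℕ) (T : I → J → K → ℝ) : Prop :=
  ∀ (a a' : Fin r → I → ℝ) (b b' : Fin r → J → ℝ) (c c' : Fin r → K → ℝ),
    IsCPDecomp r T a b c → IsCPDecomp r T a' b' c' →
      ∃ (σ : Equiv.Perm (Fin r)) (lam mu nu : Fin r → ℝ),
        (∀ k, lam k * mu k * nu k = 1) ∧
        (∀ k i, a' k i = lam k * a (σ k) i) ∧
        (∀ k j, b' k j = mu k * b (σ k) j) ∧
        (∀ k l, c' k l = nu k * c (σ k) l)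

lemma perm_of_map_eq {m s : ℕ} (β α : Fin s → Fin m)
    (h : Finset.univ.val.map β = Finset.univ.val.map α) :
    ∃ σ : Equiv.Perm (Fin s), β = α ∘ σ := by
  classical
  have e : ∀ x, Nonempty ({a // β a = x} ≃ {a // α a = x}) := by
    intro x
    rw [← Fintype.card_eq, Fintype.card_subtype, Fintype.card_subtype]
    have := congrArg (Multiset.count x) h
    simp only [Multiset.count_map, eq_comm (a := x)] at this
    exact this
  refine ⟨Equiv.ofFiberEquiv fun x => (e x).some, ?_⟩
  funext a
  exact (Equiv.ofFiberEquiv_map (fun x => (e x).some) a).symm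

open MvPolynomial in
lemma prod_X_eq {m s : ℕ} (β : Fin s → Fin m) :
    (∏ t, (X (β t) : MvPolynomial (Fin m) ℝ))
      = monomial (Multiset.toFinsupp (Finset.univ.val.map β)) 1 := by
  have h : Multiset.toFinsupp (Finset.univ.val.map β) = ∑ t, Finsupp.single (β t) 1 := by
    rw [← Multiset.toFinsupp.symm.injective.eq_iff, AddEquiv.symm_apply_apply, map_sum]
    have h1 : ∀ t, Multiset.toFinsupp.symm (Finsupp.single (β t) 1) = {β t} := by
      intro t
      simp [Multiset.toFinsupp, Finsupp.toMultiset_single]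
    simp only [h1]
    rw [Finset.sum_eq_multiset_sum, ← Multiset.sum_map_singleton (Finset.univ.val.map β),
      Multiset.map_map]
    rfl
  rw [h, monomial_sum_one]
  rfl

open MvPolynomial in
lemma sym_zero {m d : ℕ} (T : (s : Fin d) → (Fin ((s : ℕ) + 1) → Fin m) → ℝ)
    (hs : ∀ s, SymT (T s))
    (h0 : ∀ u : Fin m → ℝ, ∑ s : Fin d, ∑ α, T s α * ∏ t, u (α t) = 0)
    (s : Fin d) (α : Fin ((s : ℕ) + 1) → Fin m) : T s α = 0 := by
  classical
  have hP : (∑ s : Fin d, ∑ α, C (T s α) * ∏ t, (X (α t) : MvPolynomial (Fin m) ℝ)) = 0 := by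
    apply MvPolynomial.funext
    intro u
    simpa using h0 u
  have hc := congrArg (coeff (Multiset.toFinsupp (Finset.univ.val.map α))) hP
  simp only [prod_X_eq, coeff_sum, coeff_C_mul, coeff_monomial, coeff_zero,
    EmbeddingLike.apply_eq_iff_eq] at hc
  rw [Finset.sum_eq_single s] at hc
  · have h2 : ∀ β : Fin ((s : ℕ) + 1) → Fin m,
        T s β * (if Finset.univ.val.map β = Finset.univ.val.map α then (1 : ℝ) else 0)
        = T s α * (if Finset.univ.val.map β = Finset.univ.val.map α then (1 : ℝ) else 0) := by
      intro β
      split_ifs with hb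
      · obtain ⟨σ, hσ⟩ := perm_of_map_eq β α hb
        rw [hσ, hs s σ α]
      · simp
    simp only [h2] at hc
    rw [← Finset.mul_sum] at hc
    rcases mul_eq_zero.1 hc with h | h
    · exact h
    · exfalso
      have h3 := Finset.single_le_sum (s := Finset.univ)
        (f := fun β : Fin ((s : ℕ) + 1) → Fin m =>
          if Finset.univ.val.map β = Finset.univ.val.map α then (1 : ℝ) else 0)
        (fun β _ => by split_ifs <;> norm_num) (Finset.mem_univ α)
      simp only [if_true] at h3
      rw [h] at h3
      norm_num at h3
  · intro s' _ hne
    apply Finset.sum_eq_zero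
    intro β _
    rw [if_neg, mul_zero]
    intro hb
    have := congrArg Multiset.card hb
    simp at this
    exact hne (Fin.ext this)
  · simp

/-- if the polynomial map `f` (with symmetric tensor data `Φ`) admits the
decoupled representation `f(u) = Σ_k w_k g_k(v_k^T u)`, then the coefficient tensor `Q`
admits the CP decomposition `Q = Σ_k w_k ∘ v_k ∘ z_k`. -/
theorem stmt2 (m n d r : ℕ)
    (v : Fin r → Fin m → ℝ) (w : Fin r → Fin n → ℝ) (c : Fin r → Fin d → ℝ)
    (Φ : (i : Fin n) → (s : Fin d) → (Fin ((s : ℕ) + 1) → Fin m) → ℝ)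
    (hsym : ∀ i s, SymT (Φ i s))
    (hrep : ∀ (u : Fin m → ℝ) (i : Fin n), polyEval Φ u i
        = ∑ k, w k i * ∑ s : Fin d, c k s * (∑ j, v k j * u j) ^ ((s : ℕ) + 1)) :
    ∀ (i : Fin n) (j : Fin m) (p : DeltaIdx m d),
      coeffTensor Φ i j p = ∑ k, w k i * v k j * zVec d (c k) (v k) p := by
  intro i j p
  have key := sym_zero
    (fun s α => Φ i s α - ∑ k, w k i * (c k s * ∏ t, v k (α t))) ?_ ?_ p.1 (Fin.cons j p.2)
  · simp only [coeffTensor, zVec]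
    rw [sub_eq_zero.1 key]
    apply Finset.sum_congr rfl
    intro k _
    rw [Fin.prod_univ_succ]
    simp only [Fin.cons_zero, Fin.cons_succ]
    ring
  · intro s σ α
    simp only [hsym i s σ α, Function.comp]
    congr 1
    apply Finset.sum_congr rfl
    intro k _
    rw [Equiv.prod_comp σ (fun t => v k (α t))]
  · intro u
    have h := hrep u i
    simp only [polyEval] at h
    simp only [sub_mul, Finset.sum_sub_distrib]
    rw [h, sub_eq_zero]
    simp only [Finset.mul_sum, Finset.sum_mul]
    rw [Finset.sum_comm]
    apply Finset.sum_congr rfl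
    intro s _
    rw [Finset.sum_comm]
    apply Finset.sum_congr rfl
    intro k _
    rw [← Fin.prod_const, Finset.prod_univ_sum, Fintype.piFinset_univ, Finset.mul_sum, Finset.mul_sum]
    apply Finset.sum_congr rfl
    intro α _
    rw [Finset.prod_mul_distrib]
    ring
end

section
/- Let f : ℝ^m → ℝ^n admit a decoupled representation f(u) = Σ_{k=1}^r w_k g_k(v_k^T u) with univariate polynomials g_k, and let u^{(1)},…,u^{(N)} ∈ ℝ^m be sampling points. Then the Jacobian tensor J ∈ ℝ^{n×m×N} admits the CP decomposition J = Σ_{k=1}^r w_k ∘ v_k ∘ h_k, where h_k = (g_k'(v_k^T u^{(1)}), …, g_k'(v_k^T u^{(N)}))^T ∈ ℝ^N. -/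
open scoped BigOperators

/-- if `f(u) = Σ_k w_k g_k(v_k^T u)` with univariate polynomials `g_k`, then
the Jacobian tensor at sampling points `pts` admits the CP decomposition
`J = Σ_k w_k ∘ v_k ∘ h_k` with `(h_k)_l = g_k'(v_k^T u^{(l)})`. -/
theorem stmt3 (m n r N : ℕ)
    (v : Fin r → Fin m → ℝ) (w : Fin r → Fin n → ℝ)
    (g : Fin r → Polynomial ℝ)
    (f : (Fin m → ℝ) → Fin n → ℝ)
    (hf : ∀ (u : Fin m → ℝ) (i : Fin n),
      f u i = ∑ k, w k i * (g k).eval (∑ j, v k j * u j))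
    (pts : Fin N → Fin m → ℝ) :
    ∀ (i : Fin n) (j : Fin m) (l : Fin N),
      jacTensor f pts i j l =
        ∑ k, w k i * v k j *
          (Polynomial.derivative (g k)).eval (∑ j', v k j' * pts l j') := by
  intro i j l
  have hlin : ∀ k, HasFDerivAt (fun x : Fin m → ℝ => ∑ j, v k j * x j)
      (∑ j, v k j • (ContinuousLinearMap.proj (R := ℝ) (φ := fun _ : Fin m => ℝ) j))
      (pts l) := by
    intro k
    refine HasFDerivAt.fun_sum fun j _ => ?_
    exact (hasFDerivAt_apply j (pts l)).const_mul (v k j)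
  have hmain := HasFDerivAt.fun_sum (u := Finset.univ) fun k _ =>
    (((g k).hasDerivAt (∑ j', v k j' * pts l j')).comp_hasFDerivAt (pts l)
      (hlin k)).const_mul (w k i)
  have hfe : (fun x => f x i) = fun x => ∑ k, w k i *
      ((fun t => (g k).eval t) ∘ fun x : Fin m → ℝ => ∑ j, v k j * x j) x := by
    funext x
    exact hf x i
  unfold jacTensor
  rw [hfe, hmain.fderiv]
  simp only [ContinuousLinearMap.sum_apply, ContinuousLinearMap.smul_apply,
    ContinuousLinearMap.proj_apply, smul_eq_mul]
  refine Finset.sum_congr rfl fun k _ => ?_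
  simp [Pi.single_apply]
  ring
end

section
/- For any sampling points u^{(1)},…,u^{(N)} ∈ ℝ^m, the rank of the Vandermonde-like matrix A ∈ ℝ^{δ×N} with columns A_{:,j} = [1 | 2(u^{(j)})^T | 3(u^{(j)}⊗u^{(j)})^T | ⋯ | d(u^{(j)}⊗⋯⊗u^{(j)})^T]^T is at most M = C(m+d−1, d−1), the binomial coefficient binom(m+d−1, d−1). -/
open scoped BigOperators

/-- the rank of the Vandermonde-like matrix `A ∈ ℝ^{δ×N}` is at most
`M = C(m+d-1, d-1)`. -/
theorem stmt6 (m d N : ℕ) (pts : Fin N → Fin m → ℝ) :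
    (vdm m d N pts).rank ≤ (m + d - 1).choose (d - 1) := by
  classical
  rcases Nat.eq_zero_or_pos d with hd | hd
  · subst hd
    have h := Matrix.rank_le_card_height (vdm m 0 N pts)
    have h0 : Fintype.card (DeltaIdx m 0) = 0 := Fintype.card_eq_zero
    omega
  · let g : DeltaIdx m d → Sym (Option (Fin m)) (d - 1) := fun p =>
      ⟨(Finset.univ.val.map fun i => some (p.2 i)) + Multiset.replicate (d - 1 - p.1) none, by
        have := p.1.2
        simp
        omega⟩
    let B : Matrix (Sym (Option (Fin m)) (d - 1)) (Fin N) ℝ :=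
      Matrix.of fun q j => ((q : Multiset (Option (Fin m))).map
        fun o => o.elim 1 (pts j)).prod
    let E : Matrix (DeltaIdx m d) (Sym (Option (Fin m)) (d - 1)) ℝ :=
      Matrix.of fun p q => if q = g p then ((p.1 : ℕ) + 1 : ℝ) else 0
    have hA : vdm m d N pts = E * B := by
      ext p j
      rw [Matrix.mul_apply, Finset.sum_eq_single (g p)]
      · have hE : E p (g p) = ((p.1 : ℕ) + 1 : ℝ) := if_pos rfl
        have hB : B (g p) j = ∏ i, pts j (p.2 i) := by
          change (((Finset.univ.val.map fun i => some (p.2 i)) +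
            Multiset.replicate (d - 1 - p.1) none).map fun o : Option (Fin m) => o.elim 1 (pts j)).prod = _
          rw [Multiset.map_add, Multiset.prod_add, Multiset.map_map, Multiset.map_replicate,
            Multiset.prod_replicate]
          simp [Finset.prod, Function.comp_def]
        rw [hE, hB]
        rfl
      · intro q _ hq
        have hE : E p q = 0 := if_neg hq
        rw [hE, zero_mul]
      · intro h
        exact absurd (Finset.mem_univ _) h
    rw [hA]
    have h1 := Matrix.rank_mul_le_right E B
    have h2 := Matrix.rank_le_card_height B
    have h3 : Fintype.card (Sym (Option (Fin m)) (d - 1)) = (m + d - 1).choose (d - 1) := by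
      rw [Sym.card_sym_eq_choose]
      congr 1
      simp
      omega
    omega
end

section
/- If N ≥ M = C(m+d−1, d−1), then there exist sampling points u^{(1)},…,u^{(N)} ∈ ℝ^m such that the Vandermonde-like matrix A ∈ ℝ^{δ×N} with columns A_{:,j} = [1 | 2(u^{(j)})^T | 3(u^{(j)}⊗u^{(j)})^T | ⋯ | d(u^{(j)}⊗⋯⊗u^{(j)})^T]^T has rank exactly M. -/
open scoped BigOperators

abbrev SymIdx (m d : ℕ) : Type := Σ s : Fin d, Sym (Fin m) (s : ℕ)

theorem card_SymIdx (m d : ℕ) (hd : 1 ≤ d) :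
    Fintype.card (SymIdx m d) = (m + d - 1).choose (d - 1) := by
  obtain ⟨k, rfl⟩ : ∃ k, d = k + 1 := ⟨d - 1, by omega⟩
  rw [Fintype.card_sigma]
  simp only [Sym.card_sym_eq_multichoose, Fintype.card_fin]
  rw [Fin.sum_univ_eq_sum_range (fun i => m.multichoose i), Nat.sum_range_multichoose]
  rw [show m + (k + 1) - 1 = k + m by omega, show k + 1 - 1 = k by omega]
  exact (Nat.choose_symm_add).symm

def typ {m d : ℕ} (p : DeltaIdx m d) : SymIdx m d :=
  ⟨p.1, ⟨Finset.univ.val.map p.2, by simp⟩⟩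

theorem typ_surjective (m d : ℕ) : Function.Surjective (typ (m := m) (d := d)) := by
  rintro ⟨s, ⟨t, ht⟩⟩
  obtain ⟨l, rfl⟩ := Quot.exists_rep t
  have hl : l.length = s := by simpa using ht
  refine ⟨⟨s, fun i => l.get (i.cast hl.symm)⟩, ?_⟩
  unfold typ
  congr 2
  rw [Fin.univ_val_map]
  refine congrArg _ ?_
  apply List.ext_get
  · simp [hl]
  · intro n h1 h2
    simp

def mon {m d : ℕ} (x : Fin m → ℝ) (e : SymIdx m d) : ℝ :=
  ((e.2 : Multiset (Fin m)).map x).prod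

theorem toFinsupp_inj {m d : ℕ} :
    Function.Injective (fun e : SymIdx m d => Multiset.toFinsupp (e.2 : Multiset (Fin m))) := by
  rintro ⟨s, t, ht⟩ ⟨s', t', ht'⟩ h
  have h2 : t = t' := Multiset.toFinsupp.injective h
  subst h2
  have h3 : s = s' := Fin.ext (ht.symm.trans ht')
  subst h3
  rfl

theorem span_mon (m d : ℕ) :
    Submodule.span ℝ (Set.range (mon : (Fin m → ℝ) → SymIdx m d → ℝ)) = ⊤ := by
  classical
  by_contra hne
  obtain ⟨f, hf, hle⟩ := Submodule.exists_le_ker_of_lt_top _ (lt_top_iff_ne_top.2 hne)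
  apply hf
  let P : MvPolynomial (Fin m) ℝ := ∑ e : SymIdx m d,
    MvPolynomial.monomial (Multiset.toFinsupp (e.2 : Multiset (Fin m))) (f (Pi.single e 1))
  have hfx : ∀ v : SymIdx m d → ℝ, f v = ∑ e, f (Pi.single e 1) * v e := by
    intro v
    conv_lhs => rw [← Finset.univ_sum_single v]
    rw [map_sum]
    refine Finset.sum_congr rfl fun e _ => ?_
    rw [show (Pi.single e (v e) : SymIdx m d → ℝ) = v e • Pi.single e 1 by
      rw [← Pi.single_smul]; simp]
    rw [map_smul, smul_eq_mul, mul_comm]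
  have hP : P = 0 := by
    apply MvPolynomial.funext
    intro x
    have h0 : f (mon x) = 0 := hle (Submodule.subset_span ⟨x, rfl⟩)
    rw [hfx] at h0
    rw [map_zero, ← h0, map_sum]
    refine Finset.sum_congr rfl fun e _ => ?_
    rw [MvPolynomial.eval_monomial]
    congr 1
    unfold mon
    rw [Finset.prod_multiset_map_count]
    rfl
  have hc : ∀ e : SymIdx m d, f (Pi.single e 1) = 0 := by
    intro e
    have := congrArg (MvPolynomial.coeff (Multiset.toFinsupp (e.2 : Multiset (Fin m)))) hP
    rw [MvPolynomial.coeff_sum] at this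
    simp only [MvPolynomial.coeff_monomial, MvPolynomial.coeff_zero] at this
    rw [Finset.sum_eq_single e] at this
    · simpa using this
    · intro b _ hb
      rw [if_neg]
      exact fun h => hb (toFinsupp_inj h)
    · simp
  ext v
  simp [hc]

def liftL (m d : ℕ) : (SymIdx m d → ℝ) →ₗ[ℝ] (DeltaIdx m d → ℝ) where
  toFun w := fun p => ((p.1 : ℕ) + 1 : ℝ) * w (typ p)
  map_add' a b := by ext p; simp [mul_add]
  map_smul' a b := by ext p; simp [mul_left_comm]

theorem liftL_inj (m d : ℕ) : Function.Injective (liftL m d) := by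
  intro a b h
  ext e
  obtain ⟨p, rfl⟩ := typ_surjective m d e
  have := congrFun h p
  exact mul_left_cancel₀ (by positivity : ((p.1 : ℕ) + 1 : ℝ) ≠ 0) this

theorem vdm_col (m d N : ℕ) (pts : Fin N → Fin m → ℝ) :
    (vdm m d N pts).col = fun j => liftL m d (mon (pts j)) := by
  ext j p
  simp [vdm, liftL, mon, typ, Matrix.col, List.prod_ofFn]

theorem exists_pts (m d N : ℕ) (hd : 1 ≤ d)
    (hN : (m + d - 1).choose (d - 1) ≤ N) :
    ∃ pts : Fin N → Fin m → ℝ,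
      Submodule.span ℝ (Set.range fun j => (mon (pts j) : SymIdx m d → ℝ)) = ⊤ := by
  obtain ⟨b, hb, hs, hl⟩ := exists_linearIndependent ℝ
    (Set.range (mon : (Fin m → ℝ) → SymIdx m d → ℝ))
  rw [span_mon] at hs
  have : Fintype b := hl.setFinite.fintype
  have hcard : Fintype.card b ≤ N := by
    have := hl.fintype_card_le_finrank
    rw [Module.finrank_fintype_fun_eq_card, card_SymIdx m d hd] at this
    exact le_trans this hN
  have hMpos : 0 < Fintype.card (SymIdx m d) := by
    rw [card_SymIdx m d hd]; exact Nat.choose_pos (by omega)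
  have hne : Nonempty b := by
    rw [Set.nonempty_coe_sort, Set.nonempty_iff_ne_empty]
    rintro rfl
    have h1 : Module.finrank ℝ (SymIdx m d → ℝ) = 0 := by
      rw [← finrank_top, ← hs]; simp
    rw [Module.finrank_fintype_fun_eq_card] at h1
    omega
  obtain ⟨g⟩ : Nonempty (b ↪ Fin N) :=
    Function.Embedding.nonempty_of_card_le (by simpa using hcard)
  choose q hq using fun y : b => hb y.2
  refine ⟨fun j => q (Function.invFun g j), ?_⟩
  rw [← top_le_iff, ← hs]
  apply Submodule.span_mono
  intro y hy
  refine ⟨g ⟨y, hy⟩, ?_⟩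
  simp only [hq]
  rw [Function.leftInverse_invFun g.injective]

/-- if `N ≥ M = C(m+d-1, d-1)`, then there are sampling points whose
Vandermonde-like matrix has rank exactly `M`. -/
theorem stmt9 (m d N : ℕ) (hd : 1 ≤ d)
    (hN : (m + d - 1).choose (d - 1) ≤ N) :
    ∃ pts : Fin N → Fin m → ℝ,
      (vdm m d N pts).rank = (m + d - 1).choose (d - 1) := by
  obtain ⟨pts, hpts⟩ := exists_pts m d N hd hN
  refine ⟨pts, ?_⟩
  rw [Matrix.rank_eq_finrank_span_cols, vdm_col]
  rw [show (Set.range fun j => liftL m d (mon (pts j))) =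
    liftL m d '' (Set.range fun j => (mon (pts j) : SymIdx m d → ℝ)) by
      rw [← Set.range_comp]; rfl]
  rw [← Submodule.map_span, hpts, Submodule.map_top,
    LinearMap.finrank_range_of_inj (liftL_inj m d), Module.finrank_fintype_fun_eq_card,
    card_SymIdx m d hd]
end

section
/- Let f : ℝ^m → ℝ^n be a polynomial map of degree d with coefficient tensor Q ∈ ℝ^{n×m×δ}, let u^{(1)},…,u^{(N)} ∈ ℝ^m be sampling points whose Vandermonde-like matrix A ∈ ℝ^{δ×N} has rank M = C(m+d−1, d−1), and let J ∈ ℝ^{n×m×N} be the Jacobian tensor of f at these points. Then the CP rank of J equals the CP rank of Q. -/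
open scoped BigOperators

lemma cp_perm_of_ofFn {m s : ℕ} (f g : Fin s → Fin m)
    (h : (List.ofFn f).Perm (List.ofFn g)) : ∃ σ : Equiv.Perm (Fin s), g = f ∘ σ := by
  have key : f ∘ Tuple.sort f = g ∘ Tuple.sort g :=
    List.ofFn_injective <|
      ((((Tuple.sort f).ofFn_comp_perm f).trans h).trans
        ((Tuple.sort g).ofFn_comp_perm g).symm).eq_of_pairwise'
        (Tuple.monotone_sort f).sortedLE_ofFn.pairwise
        (Tuple.monotone_sort g).sortedLE_ofFn.pairwise
  refine ⟨(Tuple.sort g).symm.trans (Tuple.sort f), ?_⟩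
  funext i
  have := congrFun key ((Tuple.sort g).symm i)
  simpa using this.symm

def cpKey (m d : ℕ) (p : DeltaIdx m d) : Sym (Option (Fin m)) (d - 1) :=
  ⟨((List.ofFn p.2 : List (Fin m)) : Multiset (Fin m)).map some
    + Multiset.replicate (d - 1 - p.1) none, by
    have := p.1.2
    simp
    omega⟩

lemma cpKey_eq {m d : ℕ} (v : DeltaIdx m d → ℝ)
    (hv : ∀ (s : Fin d) (σ : Equiv.Perm (Fin (s : ℕ))) (α : Fin (s : ℕ) → Fin m),
      v ⟨s, α ∘ σ⟩ = v ⟨s, α⟩) : v.FactorsThrough (cpKey m d) := by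
  rintro ⟨s, α⟩ ⟨t, β⟩ h
  have h1 := congrArg Subtype.val h
  simp only [cpKey] at h1
  have h2 := congrArg (Multiset.count none) h1
  have hz : ∀ l : Multiset (Fin m), Multiset.count none (l.map some) = 0 := by
    intro l
    simp [Multiset.count_eq_zero]
  rw [Multiset.count_add, Multiset.count_add, hz, hz, Multiset.count_replicate_self,
    Multiset.count_replicate_self] at h2
  have hst : s = t := by
    apply Fin.ext
    have := s.2
    have := t.2
    omega
  subst hst
  have h3 := Multiset.map_injective (Option.some_injective _) (add_right_cancel h1)
  obtain ⟨σ, rfl⟩ := cp_perm_of_ofFn α β (Multiset.coe_eq_coe.mp h3)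
  exact (hv s σ α).symm

lemma cp_mem {m d : ℕ} (v : DeltaIdx m d → ℝ)
    (hv : ∀ (s : Fin d) (σ : Equiv.Perm (Fin (s : ℕ))) (α : Fin (s : ℕ) → Fin m),
      v ⟨s, α ∘ σ⟩ = v ⟨s, α⟩) :
    v ∈ LinearMap.range (LinearMap.funLeft ℝ ℝ (cpKey m d)) :=
  ⟨Function.extend (cpKey m d) v (fun _ => (0 : ℝ)), (cpKey_eq v hv).extend_comp (fun _ => (0 : ℝ))⟩

lemma cp_mono {I J K K' : Type*} (T : I → J → K → ℝ) (T' : I → J → K' → ℝ)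
    (g : (K → ℝ) →ₗ[ℝ] (K' → ℝ)) (hg : ∀ i j, T' i j = g (T i j)) (r : ℕ)
    (h : ∃ a b c, IsCPDecomp r T a b c) : ∃ a b c, IsCPDecomp r T' a b c := by
  obtain ⟨a, b, c, h⟩ := h
  refine ⟨a, b, fun l => g (c l), fun i j k => ?_⟩
  have : T i j = ∑ l, (a l i * b l j) • c l := by
    funext k
    simp [h i j k]
  rw [hg, this]
  simp

lemma cp_jac {m n d N : ℕ}
    (Φ : (i : Fin n) → (s : Fin d) → (Fin ((s : ℕ) + 1) → Fin m) → ℝ)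
    (hsym : ∀ i s, SymT (Φ i s)) (pts : Fin N → Fin m → ℝ) (i : Fin n) (j : Fin m) (l : Fin N) :
    jacTensor (polyEval Φ) pts i j l = ∑ p, coeffTensor Φ i j p * vdm m d N pts p l := by
  classical
  unfold jacTensor polyEval
  have hd : HasFDerivAt (fun x : Fin m → ℝ =>
      ∑ s : Fin d, ∑ α : Fin ((s : ℕ) + 1) → Fin m, Φ i s α * ∏ t, x (α t))
      (∑ s : Fin d, ∑ α : Fin ((s : ℕ) + 1) → Fin m, Φ i s α •
        ∑ t, (∏ t' ∈ Finset.univ.erase t, pts l (α t')) •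
          (ContinuousLinearMap.proj (R := ℝ) (φ := fun _ : Fin m => ℝ) (α t))) (pts l) := by
    refine HasFDerivAt.fun_sum fun s _ => HasFDerivAt.fun_sum fun α _ => ?_
    refine HasFDerivAt.const_mul ?_ _
    exact HasFDerivAt.finsetProd fun t _ => hasFDerivAt_apply _ _
  rw [hd.fderiv]
  simp only [ContinuousLinearMap.sum_apply, ContinuousLinearMap.smul_apply,
    ContinuousLinearMap.proj_apply, smul_eq_mul]
  rw [Fintype.sum_sigma]
  refine Finset.sum_congr rfl fun s _ => ?_
  simp only [Finset.mul_sum]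
  rw [Finset.sum_comm]
  have hE : ∀ t : Fin ((s : ℕ) + 1), ∀ β : Fin ((s : ℕ) + 1) → Fin m,
      ∏ t' ∈ Finset.univ.erase t, pts l (β t') = ∏ t', pts l (β (t.succAbove t')) := by
    intro t β
    have : (Finset.univ.erase t) = Finset.univ.map t.succAboveEmb := by
      rw [Fin.univ_succAbove _ t]
      simp
    rw [this, Finset.prod_map]
    rfl
  have hT : ∀ t : Fin ((s : ℕ) + 1), ∑ α : Fin ((s : ℕ) + 1) → Fin m,
      Φ i s α * ((∏ t' ∈ Finset.univ.erase t, pts l (α t')) *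
        (Pi.single j (1 : ℝ) : Fin m → ℝ) (α t))
      = ∑ β : Fin (s : ℕ) → Fin m, Φ i s (Fin.cons j β) * ∏ t', pts l (β t') := by
    intro t
    rw [← (Fin.insertNthEquiv (fun _ => Fin m) t).sum_comp, Fintype.sum_prod_type,
      Finset.sum_eq_single j]
    · refine Finset.sum_congr rfl fun β _ => ?_
      rw [hE]
      have : Φ i s (t.insertNth j β) = Φ i s (Fin.cons j β) := by
        rw [← Fin.cons_comp_cycleRange]
        exact hsym i s _ _
      simp [Fin.insertNthEquiv, this]
    · intro b _ hb
      simp [Fin.insertNthEquiv, hb]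
    · simp
  rw [Finset.sum_congr rfl fun t _ => hT t]
  simp only [Finset.sum_const, Finset.card_univ, Fintype.card_fin, nsmul_eq_mul, Finset.mul_sum,
    coeffTensor, vdm, Matrix.of_apply]
  refine Finset.sum_congr rfl fun β _ => ?_
  push_cast
  ring

lemma cp_inv {m d N : ℕ} (pts : Fin N → Fin m → ℝ)
    (hA : (vdm m d N pts).rank = (m + d - 1).choose (d - 1)) :
    ∃ g : (Fin N → ℝ) →ₗ[ℝ] (DeltaIdx m d → ℝ),
      ∀ v ∈ LinearMap.range (LinearMap.funLeft ℝ ℝ (cpKey m d)),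
        g ((vdm m d N pts).transpose.mulVecLin v) = v := by
  set A := vdm m d N pts with hAdef
  set S := LinearMap.range (LinearMap.funLeft ℝ ℝ (cpKey m d)) with hS
  have hd : 0 < d := by
    rcases Nat.eq_zero_or_pos d with h | h
    · subst h
      have := A.rank_le_card_height
      simp at this hA
      omega
    · exact h
  have hle : LinearMap.range A.mulVecLin ≤ S := by
    rw [Matrix.range_mulVecLin, Submodule.span_le]
    rintro _ ⟨l, rfl⟩
    apply cp_mem
    intro s σ α
    simp only [hAdef, vdm, Matrix.col_apply, Matrix.of_apply, Function.comp]
    rw [Equiv.prod_comp σ (fun i => pts l (α i))]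
  have hdim : Module.finrank ℝ S ≤ Module.finrank ℝ (LinearMap.range A.mulVecLin) := by
    refine (LinearMap.finrank_range_le _).trans ?_
    rw [Module.finrank_fintype_fun_eq_card, Sym.card_sym_eq_multichoose, Nat.multichoose_eq]
    change _ ≤ A.rank
    rw [hA]
    simp only [Fintype.card_option, Fintype.card_fin]
    apply le_of_eq
    congr 1
    omega
  have heq : LinearMap.range A.mulVecLin = S := Submodule.eq_of_le_of_finrank_le hle hdim
  obtain ⟨g, hg⟩ := (A.transpose.mulVecLin.domRestrict S).exists_leftInverse_of_injective (by
    rw [LinearMap.ker_eq_bot']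
    rintro ⟨v, hv⟩ h
    rw [← heq] at hv
    obtain ⟨w, rfl⟩ := hv
    have h2 : w ∈ LinearMap.ker (A.transpose * A).mulVecLin := by
      simpa [LinearMap.mem_ker, Matrix.mulVec_mulVec] using h
    rw [Matrix.ker_mulVecLin_transpose_mul_self] at h2
    exact Subtype.ext h2)
  refine ⟨S.subtype.comp g, fun v hv => ?_⟩
  have := LinearMap.congr_fun hg ⟨v, hv⟩
  exact congrArg Subtype.val this



/-- if the Vandermonde-like matrix of the sampling points has full rank
`M = C(m+d-1, d-1)`, then the CP rank of the Jacobian tensor equals the CP rank of the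
coefficient tensor. -/
theorem stmt10 (m n d N : ℕ)
    (Φ : (i : Fin n) → (s : Fin d) → (Fin ((s : ℕ) + 1) → Fin m) → ℝ)
    (hsym : ∀ i s, SymT (Φ i s))
    (pts : Fin N → Fin m → ℝ)
    (hA : (vdm m d N pts).rank = (m + d - 1).choose (d - 1)) :
    cpRank (jacTensor (polyEval Φ) pts) = cpRank (coeffTensor Φ) := by
  have hJ : ∀ i j, jacTensor (polyEval Φ) pts i j
      = (vdm m d N pts).transpose.mulVecLin (coeffTensor Φ i j) := by
    intro i j
    funext l
    rw [cp_jac Φ hsym]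
    simp [Matrix.vecMul, dotProduct]
  obtain ⟨g, hg⟩ := cp_inv pts hA
  have hQ : ∀ i j, coeffTensor Φ i j = g (jacTensor (polyEval Φ) pts i j) := by
    intro i j
    rw [hJ, hg]
    apply cp_mem
    intro s σ α
    let τ : Equiv.Perm (Fin ((s : ℕ) + 1)) := Equiv.Perm.decomposeFin.symm (0, σ)
    have : (Fin.cons j (α ∘ σ) : Fin ((s : ℕ) + 1) → Fin m)
        = (Fin.cons j α : Fin ((s : ℕ) + 1) → Fin m) ∘ τ := by
      funext x
      refine Fin.cases ?_ (fun x => ?_) x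
      · simp [τ]
      · simp [τ]
    simp only [coeffTensor]
    rw [this]
    exact hsym i s τ _
  unfold cpRank
  congr 1
  ext r
  exact ⟨cp_mono _ _ g hQ r, cp_mono _ _ _ hJ r⟩
end

section
/- Let f : ℝ^m → ℝ^n be a polynomial map of degree d with coefficient tensor Q ∈ ℝ^{n×m×δ}, and let u^{(1)},…,u^{(N)} ∈ ℝ^m be sampling points whose Vandermonne-like matrix A ∈ ℝ^{δ×N} has rank M = C(m+d−1, d−1), with Jacobian tensor J ∈ ℝ^{n×m×N}. Then there exists a matrix B ∈ ℝ^{δ×N} such that Q_{i,j,s} = Σ_{l=1}^N B_{s,l} J_{i,j,l} for all i,j,s; that is, Q can be recovered from J by a mode-3 multiplication. -/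
open scoped BigOperators

lemma exists_perm_of_map_eq {m s : ℕ} (α β : Fin s → Fin m)
    (h : Multiset.map α Finset.univ.val = Multiset.map β Finset.univ.val) :
    ∃ σ : Equiv.Perm (Fin s), α = β ∘ σ := by
  have e : ∀ γ : Fin s → Fin m, Multiset.map γ Finset.univ.val = (List.ofFn γ : Multiset (Fin m)) := by
    intro γ
    rw [List.ofFn_eq_map]
    rfl
  rw [e, e, Multiset.coe_eq_coe] at h
  have h1 : (List.ofFn (α ∘ Tuple.sort α)).Perm (List.ofFn (β ∘ Tuple.sort β)) :=
    ((Equiv.Perm.ofFn_comp_perm _ _).trans h).trans (Equiv.Perm.ofFn_comp_perm _ _).symm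
  have h2 : α ∘ Tuple.sort α = β ∘ Tuple.sort β :=
    List.ofFn_injective (h1.eq_of_pairwise' (Tuple.monotone_sort α).sortedLE_ofFn.pairwise
      (Tuple.monotone_sort β).sortedLE_ofFn.pairwise)
  refine ⟨(Tuple.sort α).symm.trans (Tuple.sort β), ?_⟩
  funext i
  have := congrFun h2 ((Tuple.sort α).symm i)
  simpa using this

lemma sum_multichoose (m k : ℕ) :
    ∑ s : Fin (k + 1), Nat.multichoose m s = Nat.multichoose (m + 1) k := by
  rw [Fin.sum_univ_eq_sum_range (fun s => Nat.multichoose m s) (k + 1)]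
  induction k with
  | zero => simp
  | succ k ih => rw [Finset.sum_range_succ, ih, Nat.multichoose_succ_succ, add_comm]

/-- symmetric vectors -/
def symSub (m d : ℕ) : Submodule ℝ (DeltaIdx m d → ℝ) where
  carrier := {w | ∀ (s : Fin d) (σ : Equiv.Perm (Fin (s : ℕ))) (α : Fin (s : ℕ) → Fin m),
    w ⟨s, α ∘ σ⟩ = w ⟨s, α⟩}
  add_mem' := by
    intro a b ha hb s σ α
    simp [ha s σ α, hb s σ α]
  zero_mem' := by intro s σ α; rfl
  smul_mem' := by
    intro c a ha s σ α
    simp [ha s σ α]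

def toSymIdx (m d : ℕ) (p : DeltaIdx m d) : Σ s : Fin d, Sym (Fin m) (s : ℕ) :=
  ⟨p.1, ⟨Multiset.map p.2 Finset.univ.val, by simp⟩⟩

lemma finrank_symSub_le (m d : ℕ) (hd : 0 < d) :
    Module.finrank ℝ (symSub m d) ≤ (m + d - 1).choose (d - 1) := by
  have h1 : symSub m d ≤ LinearMap.range (LinearMap.funLeft ℝ ℝ (toSymIdx m d)) := by
    intro w hw
    have : Function.FactorsThrough w (toSymIdx m d) := by
      rintro ⟨s, α⟩ ⟨t, β⟩ h
      obtain rfl : s = t := congrArg Sigma.fst h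
      replace h := congrArg Subtype.val (eq_of_heq (Sigma.mk.inj h).2)
      obtain ⟨σ, rfl⟩ := exists_perm_of_map_eq α β h
      exact hw s σ β
    obtain ⟨e, he⟩ := (Function.factorsThrough_iff w).1 this
    exact ⟨e, he.symm⟩
  refine (Submodule.finrank_mono h1).trans ((LinearMap.finrank_range_le _).trans ?_)
  obtain ⟨k, rfl⟩ : ∃ k, d = k + 1 := ⟨d - 1, by omega⟩
  rw [Module.finrank_fintype_fun_eq_card, Fintype.card_sigma]
  simp only [Sym.card_sym_eq_multichoose, Fintype.card_fin]
  rw [sum_multichoose, Nat.multichoose_eq]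
  apply le_of_eq
  congr 1
  omega

lemma vdm_range_le (m d N : ℕ) (pts : Fin N → Fin m → ℝ) :
    LinearMap.range (vdm m d N pts).mulVecLin ≤ symSub m d := by
  rintro _ ⟨x, rfl⟩ s σ α
  simp only [Matrix.mulVecLin_apply, Matrix.mulVec, dotProduct, vdm, Matrix.of_apply,
    Function.comp_apply]
  refine Finset.sum_congr rfl fun l _ => ?_
  rw [Equiv.prod_comp σ (fun i => pts l (α i))]

lemma mono_deriv {m s : ℕ} (α : Fin (s + 1) → Fin m) (u : Fin m → ℝ) :
    HasFDerivAt (fun x : Fin m → ℝ => ∏ t, x (α t))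
      (∑ t, (∏ t', u (α (t.succAbove t'))) •
        (ContinuousLinearMap.proj (α t) : (Fin m → ℝ) →L[ℝ] ℝ)) u := by
  have := HasFDerivAt.finsetProd (u := Finset.univ) (x := u)
    (g := fun (t : Fin (s + 1)) (x : Fin m → ℝ) => x (α t))
    (g' := fun t => (ContinuousLinearMap.proj (α t) : (Fin m → ℝ) →L[ℝ] ℝ))
    (fun t _ => hasFDerivAt_apply (α t) u)
  refine this.congr_fderiv ?_
  refine Finset.sum_congr rfl fun t _ => ?_
  congr 1
  rw [← Finset.compl_singleton, ← Fin.image_succAbove_univ,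
    Finset.prod_image (by intro a _ b _ h; exact Fin.succAbove_right_injective h)]

lemma block_sum {m s : ℕ} (T : (Fin (s + 1) → Fin m) → ℝ) (hT : SymT T) (u : Fin m → ℝ)
    (j : Fin m) :
    ∑ α, T α * ∑ t, (∏ t', u (α (t.succAbove t'))) * (Pi.single j 1 : Fin m → ℝ) (α t) =
      ∑ β : Fin s → Fin m, T (Fin.cons j β) * (((s : ℝ) + 1) * ∏ i, u (β i)) := by
  simp_rw [Finset.mul_sum]
  rw [Finset.sum_comm]
  have key : ∀ t : Fin (s + 1), ∑ α, T α * ((∏ t', u (α (t.succAbove t'))) *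
      (Pi.single j 1 : Fin m → ℝ) (α t)) =
      ∑ β : Fin s → Fin m, T (Fin.cons j β) * ∏ i, u (β i) := by
    intro t
    rw [← Equiv.sum_comp (Fin.insertNthEquiv (fun _ => Fin m) t), Fintype.sum_prod_type,
      Finset.sum_eq_single j]
    · refine Finset.sum_congr rfl fun β _ => ?_
      simp only [Fin.insertNthEquiv_apply, Fin.insertNth_apply_succAbove,
        Fin.insertNth_apply_same, Pi.single_eq_same, mul_one]
      rw [← hT t.cycleRange.symm]
      have e : ((Fin.insertNthEquiv (fun _ => Fin m) t) (j, β) ∘ t.cycleRange.symm :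
          Fin (s + 1) → Fin m) = Fin.cons j β := Fin.insertNth_comp_cycleRange_symm t j β
      rw [e]
    · intro b _ hb
      refine Finset.sum_eq_zero fun β _ => ?_
      simp [Pi.single_eq_of_ne hb]
    · simp
  simp_rw [key]
  rw [Finset.sum_const, Finset.card_univ, Fintype.card_fin, nsmul_eq_mul, Finset.mul_sum]
  refine Finset.sum_congr rfl fun β _ => ?_
  push_cast
  ring

lemma jac_eq {m n d N : ℕ}
    (Φ : (i : Fin n) → (s : Fin d) → (Fin ((s : ℕ) + 1) → Fin m) → ℝ)
    (hsym : ∀ i s, SymT (Φ i s)) (pts : Fin N → Fin m → ℝ) (i : Fin n) (j : Fin m) (l : Fin N) :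
    jacTensor (polyEval Φ) pts i j l =
      ((vdm m d N pts).transpose.mulVec (coeffTensor Φ i j)) l := by
  have h : HasFDerivAt (fun x => polyEval Φ x i)
      (∑ s : Fin d, ∑ α : Fin ((s : ℕ) + 1) → Fin m, Φ i s α •
        (∑ t, (∏ t', pts l (α (t.succAbove t'))) •
        (ContinuousLinearMap.proj (α t) : (Fin m → ℝ) →L[ℝ] ℝ))) (pts l) := by
    unfold polyEval
    refine HasFDerivAt.fun_sum fun s _ => HasFDerivAt.fun_sum fun α _ => ?_
    exact (mono_deriv α (pts l)).const_mul _
  unfold jacTensor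
  rw [h.fderiv]
  simp only [ContinuousLinearMap.sum_apply, ContinuousLinearMap.smul_apply,
    ContinuousLinearMap.proj_apply, smul_eq_mul]
  simp_rw [fun s => block_sum (Φ i s) (hsym i s) (pts l) j]
  simp only [Matrix.mulVec, dotProduct, Matrix.transpose_apply, vdm, Matrix.of_apply, coeffTensor]
  rw [Fintype.sum_sigma]
  refine Finset.sum_congr rfl fun s _ => Finset.sum_congr rfl fun β _ => ?_
  ring

lemma coeff_mem {m n d : ℕ}
    (Φ : (i : Fin n) → (s : Fin d) → (Fin ((s : ℕ) + 1) → Fin m) → ℝ)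
    (hsym : ∀ i s, SymT (Φ i s)) (i : Fin n) (j : Fin m) : coeffTensor Φ i j ∈ symSub m d := by
  intro s σ α
  simp only [coeffTensor]
  obtain ⟨τ, hτ⟩ := exists_perm_of_map_eq (Fin.cons j (α ∘ σ) : Fin ((s : ℕ) + 1) → Fin m)
    (Fin.cons j α) (by
      have e : ∀ γ : Fin (s : ℕ) → Fin m, Multiset.map (Fin.cons j γ : Fin ((s : ℕ) + 1) → Fin m)
          Finset.univ.val = j ::ₘ Multiset.map γ Finset.univ.val := by
        intro γ
        rw [Fin.univ_succ]
        simp [Function.comp_def]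
      rw [e, e, ← Multiset.map_map, Multiset.map_univ_val_equiv])
  rw [hτ]
  exact hsym i s τ _

/-- if the Vandermonde-like matrix of the sampling points has full rank
`M = C(m+d-1, d-1)`, then the coefficient tensor `Q` can be recovered from the Jacobian
tensor `J` by a mode-3 multiplication: `Q_{i,j,s} = Σ_l B_{s,l} J_{i,j,l}`. -/
theorem stmt11 (m n d N : ℕ)
    (Φ : (i : Fin n) → (s : Fin d) → (Fin ((s : ℕ) + 1) → Fin m) → ℝ)
    (hsym : ∀ i s, SymT (Φ i s))
    (pts : Fin N → Fin m → ℝ)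
    (hA : (vdm m d N pts).rank = (m + d - 1).choose (d - 1)) :
    ∃ B : Matrix (DeltaIdx m d) (Fin N) ℝ,
      ∀ (i : Fin n) (j : Fin m) (s : DeltaIdx m d),
        coeffTensor Φ i j s = ∑ l, B s l * jacTensor (polyEval Φ) pts i j l := by
  rcases Nat.eq_zero_or_pos d with rfl | hd
  · exact ⟨0, fun i j s => s.1.elim0⟩
  have hr : LinearMap.range (vdm m d N pts).mulVecLin = symSub m d := by
    apply Submodule.eq_of_le_of_finrank_le (vdm_range_le m d N pts)
    exact (finrank_symSub_le m d hd).trans hA.ge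
  let L : symSub m d →ₗ[ℝ] (Fin N → ℝ) :=
    (vdm m d N pts).transpose.mulVecLin.comp (symSub m d).subtype
  have hL : LinearMap.ker L = ⊥ := by
    rw [LinearMap.ker_eq_bot']
    rintro ⟨q, hq⟩ h
    have h' : (vdm m d N pts).transpose.mulVec q = 0 := h
    rw [← hr] at hq
    obtain ⟨x, rfl⟩ := hq
    have h2 : x ∈ LinearMap.ker ((vdm m d N pts).transpose * vdm m d N pts).mulVecLin := by
      rw [LinearMap.mem_ker, Matrix.mulVecLin_apply, ← Matrix.mulVec_mulVec]
      exact h'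
    rw [Matrix.ker_mulVecLin_transpose_mul_self] at h2
    exact Subtype.ext h2
  obtain ⟨G, hG⟩ := LinearMap.exists_leftInverse_of_injective L hL
  refine ⟨LinearMap.toMatrix' ((symSub m d).subtype.comp G), fun i j s => ?_⟩
  have h1 : jacTensor (polyEval Φ) pts i j = L ⟨_, coeff_mem Φ hsym i j⟩ :=
    funext fun l => jac_eq Φ hsym pts i j l
  have h2 : (LinearMap.toMatrix' ((symSub m d).subtype.comp G)).mulVec
      (jacTensor (polyEval Φ) pts i j) = coeffTensor Φ i j := by
    rw [LinearMap.toMatrix'_mulVec, h1]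
    have := LinearMap.congr_fun hG ⟨_, coeff_mem Φ hsym i j⟩
    exact congrArg Subtype.val this
  exact (congrFun h2 s).symm
end

section
/- Let f : ℝ^m → ℝ^n be a polynomial map of degree d with coefficient tensor Q ∈ ℝ^{n×m×δ}, and let u^{(1)},…,u^{(N)} ∈ ℝ^m be sampling points whose Vandermonde-like matrix A ∈ ℝ^{δ×N} has rank M = C(m+d−1, d−1), with Jacobian tensor J ∈ ℝ^{n×m×N}. If the rank-r CP decomposition of Q is essentially unique, then the rank-r CP decomposition of J is essentially unique. -/
open scoped BigOperators

lemma aux_indep {I J K : Type*} (r : ℕ) (T : I → J → K → ℝ)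
    (a : Fin r → I → ℝ) (b : Fin r → J → ℝ) (c : Fin r → K → ℝ)
    (hr : cpRank T = r) (h : IsCPDecomp r T a b c) (x : Fin r → ℝ)
    (hx : ∀ i j, ∑ l, x l * (a l i * b l j) = 0) : ∀ k, x k = 0 := by
  intro k
  by_contra hk
  obtain _ | r' := r
  · exact k.elim0
  have hmem : r' ∈ {r | ∃ a b c, IsCPDecomp r T a b c} := by
    refine ⟨fun l => a (k.succAbove l), fun l => b (k.succAbove l),
      fun l q => c (k.succAbove l) q - x (k.succAbove l) / x k * c k q, ?_⟩
    intro i j q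
    have h1 := h i j q
    have h2 := hx i j
    rw [Fin.sum_univ_succAbove _ k] at h1 h2
    have h3 : a k i * b k j
        = - ∑ l, x (k.succAbove l) / x k * (a (k.succAbove l) i * b (k.succAbove l) j) := by
      have : x k * (a k i * b k j)
          = - ∑ l, x (k.succAbove l) * (a (k.succAbove l) i * b (k.succAbove l) j) := by linarith
      apply mul_left_cancel₀ hk
      rw [this, mul_neg, Finset.mul_sum]
      congr 1
      refine Finset.sum_congr rfl fun l _ => ?_
      field_simp
    rw [h1, h3, neg_mul, Finset.sum_mul, neg_add_eq_sub, ← Finset.sum_sub_distrib]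
    refine Finset.sum_congr rfl fun l _ => ?_
    ring
  have := Nat.sInf_le hmem
  unfold cpRank at hr
  omega

lemma aux_symT_perm {m s : ℕ} {T : (Fin s → Fin m) → ℝ} (hT : SymT T) (α β : Fin s → Fin m)
    (h : (List.ofFn α).Perm (List.ofFn β)) : T α = T β := by
  have : α ∘ Tuple.sort α = β ∘ Tuple.sort β := by
    apply List.ofFn_injective
    refine List.Perm.eq_of_pairwise' 
      (Tuple.monotone_sort α).sortedLE_ofFn.pairwise (Tuple.monotone_sort β).sortedLE_ofFn.pairwise
      (((Tuple.sort α).ofFn_comp_perm α).trans (h.trans ((Tuple.sort β).ofFn_comp_perm β).symm))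
  rw [← hT (Tuple.sort α) α, this, hT]

lemma aux_symT_cons {m s : ℕ} {T : (Fin (s+1) → Fin m) → ℝ} (hT : SymT T) (j : Fin m) :
    SymT (fun α => T (Fin.cons j α)) := by
  intro σ α
  have := hT (Equiv.Perm.decomposeFin.symm (0, σ)) (Fin.cons j α)
  show T _ = T _
  rw [← this]
  congr 1
  funext t
  refine Fin.cases ?_ (fun t => ?_) t
  · simp
  · simp

def auxπ {m d : ℕ} (p : DeltaIdx m d) : Σ s : Fin d, Sym (Fin m) (s : ℕ) :=
  ⟨p.1, ⟨(List.ofFn p.2 : Multiset (Fin m)), by simp⟩⟩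

lemma aux_mem {m d : ℕ} (T : DeltaIdx m d → ℝ)
    (hT : ∀ s : Fin d, SymT (fun α : Fin (s:ℕ) → Fin m => T ⟨s, α⟩)) :
    T ∈ LinearMap.range (LinearMap.funLeft ℝ ℝ (auxπ (m := m) (d := d))) := by
  have hf : Function.FactorsThrough T (auxπ (m := m) (d := d)) := by
    rintro ⟨s, α⟩ ⟨s', β⟩ h
    obtain rfl : s = s' := congrArg Sigma.fst h
    have h2 : (⟨(List.ofFn α : Multiset (Fin m)), by simp⟩ : Sym (Fin m) (s : ℕ))
      = ⟨(List.ofFn β : Multiset (Fin m)), by simp⟩ := by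
      exact eq_of_heq (Sigma.mk.inj h).2
    have h3 := congrArg Subtype.val h2
    exact aux_symT_perm (hT s) α β (Multiset.coe_eq_coe.1 h3)
  refine ⟨Function.extend auxπ T 0, ?_⟩
  funext p
  exact hf.extend_apply 0 p

lemma aux_card (m d : ℕ) : Fintype.card (Σ s : Fin (d+1), Sym (Fin m) (s : ℕ))
    = (m + d).choose d := by
  rw [Fintype.card_sigma]
  simp only [Sym.card_sym_fin_eq_multichoose]
  rw [Fin.sum_univ_eq_sum_range (fun s => Nat.multichoose m s)]
  have : ∀ d, ∑ s ∈ Finset.range (d+1), Nat.multichoose m s = Nat.multichoose (m+1) d := by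
    intro d
    induction d with
    | zero => simp
    | succ d ih => rw [Finset.sum_range_succ, ih, Nat.multichoose_succ_succ, add_comm]
  rw [this, Nat.multichoose_eq]
  congr 1
  omega

lemma aux_vdm_range (m d N : ℕ) (pts : Fin N → Fin m → ℝ)
    (hA : (vdm m d N pts).rank = (m + d - 1).choose (d - 1)) :
    LinearMap.range (vdm m d N pts).mulVecLin
      = LinearMap.range (LinearMap.funLeft ℝ ℝ (auxπ (m := m) (d := d))) := by
  obtain _ | d := d
  · exfalso
    have := Matrix.rank_le_card_height (vdm m 0 N pts)
    simp at this hA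
    omega
  apply Submodule.eq_of_le_of_finrank_le
  · rintro _ ⟨y, rfl⟩
    apply aux_mem
    intro s σ α
    simp only [Matrix.mulVecLin_apply, Matrix.mulVec, dotProduct, vdm, Matrix.of_apply]
    refine Finset.sum_congr rfl fun l _ => ?_
    congr 2
    exact Equiv.prod_comp σ (fun i => pts l (α i))
  · have h1 := LinearMap.finrank_range_le (LinearMap.funLeft ℝ ℝ (auxπ (m := m) (d := d+1)))
    rw [Module.finrank_fintype_fun_eq_card, aux_card] at h1
    refine h1.trans ?_
    have : Module.finrank ℝ (LinearMap.range (vdm m (d+1) N pts).mulVecLin)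
      = (vdm m (d+1) N pts).rank := rfl
    rw [this, hA]
    simp

lemma aux_deriv_hom {m s : ℕ} {T : (Fin (s+1) → Fin m) → ℝ} (hT : SymT T) (u : Fin m → ℝ)
    (j : Fin m) :
    ∑ α : Fin (s+1) → Fin m, T α * ∑ t, (∏ t' ∈ Finset.univ.erase t, u (α t')) *
        (if α t = j then 1 else 0)
      = ∑ β : Fin s → Fin m, T (Fin.cons j β) * (((s:ℝ)+1) * ∏ i, u (β i)) := by
  have key : ∀ t : Fin (s+1), ∑ α : Fin (s+1) → Fin m,
      T α * ((∏ t' ∈ Finset.univ.erase t, u (α t')) * (if α t = j then 1 else 0))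
      = ∑ β : Fin s → Fin m, T (Fin.cons j β) * ∏ i, u (β i) := by
    intro t
    have h0 : ∑ α : Fin (s+1) → Fin m,
      T α * ((∏ t' ∈ Finset.univ.erase t, u (α t')) * (if α t = j then 1 else 0))
      = ∑ α : Fin (s+1) → Fin m,
      T α * ((∏ t' ∈ Finset.univ.erase 0, u (α t')) * (if α 0 = j then 1 else 0)) := by
      refine Fintype.sum_equiv ((Equiv.swap 0 t).arrowCongr (Equiv.refl _)) _ _ fun α => ?_
      have e : ((Equiv.swap 0 t).arrowCongr (Equiv.refl (Fin m))) α = α ∘ Equiv.swap 0 t := by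
        funext x; simp
      rw [e, hT]
      congr 2
      · refine Finset.prod_bij' (fun x _ => Equiv.swap 0 t x) (fun x _ => Equiv.swap 0 t x)
          ?_ ?_ ?_ ?_ ?_
        · intro x hx
          simp at hx ⊢
          intro h
          apply hx
          have := congrArg (Equiv.swap 0 t) h
          simpa using this
        · intro x hx
          simp at hx ⊢
          intro h
          apply hx
          have := congrArg (Equiv.swap 0 t) h
          simpa using this
        · simp
        · simp
        · simp
    rw [h0, ← Equiv.sum_comp (Fin.consEquiv (fun _ => Fin m)), Fintype.sum_prod_type]
    rw [Finset.sum_eq_single j]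
    · refine Finset.sum_congr rfl fun β _ => ?_
      have : (Finset.univ.erase (0 : Fin (s+1))) = Finset.univ.map (Fin.succEmb s) := by
        ext x
        refine Fin.cases ?_ (fun x => ?_) x <;> simp
      rw [this]
      simp [Fin.consEquiv]
    · intro i _ hi
      simp [Fin.consEquiv, hi]
    · simp
  simp only [Finset.mul_sum]
  rw [Finset.sum_comm]
  simp only [key]
  simp only [Finset.sum_const, Finset.card_univ, Fintype.card_fin, nsmul_eq_mul, Finset.mul_sum]
  refine Finset.sum_congr rfl fun β _ => ?_
  push_cast
  ring

lemma aux_jac {m n d N : ℕ}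
    (Φ : (i : Fin n) → (s : Fin d) → (Fin ((s : ℕ) + 1) → Fin m) → ℝ)
    (hsym : ∀ i s, SymT (Φ i s)) (pts : Fin N → Fin m → ℝ) (i : Fin n) (j : Fin m) :
    jacTensor (polyEval Φ) pts i j = (vdm m d N pts).transpose.mulVec (coeffTensor Φ i j) := by
  funext l
  have hd : HasFDerivAt (fun x => polyEval Φ x i)
      (∑ s : Fin d, ∑ α : Fin ((s : ℕ) + 1) → Fin m, Φ i s α •
        ∑ t, (∏ t' ∈ Finset.univ.erase t, pts l (α t')) •
          (ContinuousLinearMap.proj (R := ℝ) (φ := fun _ : Fin m => ℝ) (α t))) (pts l) := by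
    unfold polyEval
    refine HasFDerivAt.fun_sum fun s _ => HasFDerivAt.fun_sum fun α _ => ?_
    refine HasFDerivAt.const_mul ?_ _
    exact HasFDerivAt.finsetProd (g := fun t (x : Fin m → ℝ) => x (α t))
      fun t _ => hasFDerivAt_apply (α t) (pts l)
  unfold jacTensor
  rw [hd.fderiv]
  simp only [_root_.sum_apply, _root_.smul_apply, smul_eq_mul,
    ContinuousLinearMap.proj_apply, Matrix.mulVec, dotProduct, Matrix.transpose_apply, vdm,
    Matrix.of_apply, coeffTensor, Pi.single_apply]
  rw [Fintype.sum_sigma]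
  refine Finset.sum_congr rfl fun s _ => ?_
  rw [aux_deriv_hom (hsym i s)]
  refine Finset.sum_congr rfl fun β _ => ?_
  ring

lemma aux_leftinv {P : Type*} [Fintype P] {N : ℕ} (A : Matrix P (Fin N) ℝ) :
    ∃ B : (Fin N → ℝ) →ₗ[ℝ] (P → ℝ), ∀ x ∈ LinearMap.range A.mulVecLin,
      B (A.transpose.mulVec x) = x := by
  obtain ⟨g, hg⟩ := LinearMap.exists_leftInverse_of_injective
    (A.transpose.mulVecLin.comp (LinearMap.range A.mulVecLin).subtype) (by
      rw [LinearMap.ker_eq_bot']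
      rintro ⟨_, y, rfl⟩ h
      simp only [LinearMap.comp_apply, Submodule.subtype_apply, Matrix.mulVecLin_apply] at h
      have h2 : dotProduct (A.mulVec y) (A.mulVec y) = 0 := by
        rw [Matrix.dotProduct_mulVec, ← Matrix.mulVec_transpose, h, zero_dotProduct]
      have h3 := dotProduct_self_eq_zero.1 h2
      ext1
      simpa using h3)
  refine ⟨(LinearMap.range A.mulVecLin).subtype.comp g, fun x hx => ?_⟩
  have := LinearMap.congr_fun hg ⟨x, hx⟩
  exact congrArg Subtype.val this

/-- if the Vandermonde-like matrix of the sampling points has full rank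
`M = C(m+d-1, d-1)` and the rank-`r` CP decomposition of the coefficient tensor `Q` is
essentially unique, then the rank-`r` CP decomposition of the Jacobian tensor `J` is
essentially unique. -/
theorem stmt12 (m n d N r : ℕ)
    (Φ : (i : Fin n) → (s : Fin d) → (Fin ((s : ℕ) + 1) → Fin m) → ℝ)
    (hsym : ∀ i s, SymT (Φ i s))
    (pts : Fin N → Fin m → ℝ)
    (hA : (vdm m d N pts).rank = (m + d - 1).choose (d - 1))
    (hr : cpRank (coeffTensor Φ) = r)
    (hQ : EssUnique r (coeffTensor Φ)) :
    EssUnique r (jacTensor (polyEval Φ) pts) := by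
  intro a a' b b' c c' h h'
  obtain ⟨B, hB⟩ := aux_leftinv (vdm m d N pts)
  have hQJ : ∀ i j, coeffTensor Φ i j = B (jacTensor (polyEval Φ) pts i j) := by
    intro i j
    rw [aux_jac Φ hsym, hB]
    rw [aux_vdm_range m d N pts hA]
    exact aux_mem _ fun s => aux_symT_cons (hsym i s) j
  have hdec : ∀ (a : Fin r → Fin n → ℝ) (b : Fin r → Fin m → ℝ) (c : Fin r → Fin N → ℝ),
      IsCPDecomp r (jacTensor (polyEval Φ) pts) a b c →
      IsCPDecomp r (coeffTensor Φ) a b (fun l => B (c l)) := by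
    intro a b c h i j p
    have : jacTensor (polyEval Φ) pts i j = ∑ l, (a l i * b l j) • c l := by
      funext k
      rw [h i j k]
      simp
    rw [hQJ, this]
    simp
  obtain ⟨σ, lam, mu, nu, h1, ha, hb, -⟩ := hQ a a' b b' _ _ (hdec a b c h) (hdec a' b' c' h')
  refine ⟨σ, lam, mu, nu, h1, ha, hb, ?_⟩
  intro k q
  have key := aux_indep r _ a b _ hr (hdec a b c h)
    (fun l => lam (σ.symm l) * mu (σ.symm l) * c' (σ.symm l) q - c l q) (by
      intro i j
      have e1 := h i j q
      have e2 := h' i j q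
      rw [← Equiv.sum_comp σ]
      rw [← Equiv.sum_comp σ] at e1
      have : ∑ l, (a (σ l) i * b (σ l) j * c (σ l) q) = ∑ l, a' l i * b' l j * c' l q := by
        rw [← e1, ← e2]
      simp only [Equiv.symm_apply_apply, sub_mul, Finset.sum_sub_distrib]
      rw [sub_eq_zero]
      trans ∑ l, a' l i * b' l j * c' l q
      · refine Finset.sum_congr rfl fun l _ => ?_
        rw [ha, hb]; ring
      · rw [← this]
        refine Finset.sum_congr rfl fun l _ => ?_
        ring) (σ k)
  simp only [Equiv.symm_apply_apply] at key
  have hk := h1 k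
  linear_combination nu k * key - c' k q * hk
end

section
/- Let f : ℝ^m → ℝ^n be a polynomial map of degree d and let Q ∈ ℝ^{n×m×δ} be its coefficient tensor. Then the CP rank of Q is at most 1 if and only if there exist w ∈ ℝ^n, v ∈ ℝ^m, and a univariate polynomial g(t) = c_1 t + ⋯ + c_d t^d (with zero constant term, degree at most d) such that f(u) = w g(v^T u) for all u ∈ ℝ^m. -/
open scoped BigOperators

/-- Fiber multiset monomial exponent of a tuple. -/
noncomputable def tupExp {m s : ℕ} (α : Fin s → Fin m) : Fin m →₀ ℕ :=
  Multiset.toFinsupp (Multiset.map α Finset.univ.val)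

lemma prod_X_tup {m s : ℕ} (α : Fin s → Fin m) :
    (∏ t, (MvPolynomial.X (α t) : MvPolynomial (Fin m) ℝ)) =
      MvPolynomial.monomial (tupExp α) 1 := by
  have h : tupExp α = ∑ t, Finsupp.single (α t) 1 := by
    unfold tupExp
    have h2 : Multiset.map α Finset.univ.val = ∑ t, ({α t} : Multiset (Fin m)) := by
      rw [Finset.sum, ← Multiset.sum_map_singleton (Finset.univ.val.map α), Multiset.map_map]
      rfl
    rw [h2, map_sum]
    simp
  rw [h, MvPolynomial.monomial_sum_one]
  rfl

lemma tupExp_size {m s s' : ℕ} {α : Fin s → Fin m} {β : Fin s' → Fin m}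
    (h : tupExp α = tupExp β) : s = s' := by
  have := congrArg Multiset.card (Multiset.toFinsupp.injective h)
  simpa using this

lemma tupExp_perm {m s : ℕ} {α β : Fin s → Fin m}
    (h : tupExp α = tupExp β) : ∃ σ : Equiv.Perm (Fin s), α = β ∘ σ := by
  classical
  have hm := Multiset.toFinsupp.injective h
  have hc : ∀ j, Nonempty ({t // α t = j} ≃ {t // β t = j}) := by
    intro j
    have h1 := congrArg (Multiset.count j) hm
    rw [Multiset.count_map, Multiset.count_map] at h1
    refine ⟨Fintype.equivOfCardEq ?_⟩
    rw [Fintype.card_subtype, Fintype.card_subtype]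
    simp only [eq_comm (a := j)] at h1
    exact h1
  let e := fun j => Classical.choice (hc j)
  refine ⟨(Equiv.sigmaFiberEquiv α).symm.trans
    ((Equiv.sigmaCongrRight e).trans (Equiv.sigmaFiberEquiv β)), ?_⟩
  ext t
  exact congrArg Fin.val ((e (α t)) ⟨t, rfl⟩).2.symm

lemma symT_zero {m d : ℕ} (Ψ : (s : Fin d) → (Fin ((s : ℕ) + 1) → Fin m) → ℝ)
    (hs : ∀ s, SymT (Ψ s))
    (h : ∀ u : Fin m → ℝ, ∑ s : Fin d, ∑ α : Fin ((s : ℕ) + 1) → Fin m,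
      Ψ s α * ∏ t, u (α t) = 0) (s : Fin d) (α : Fin ((s : ℕ) + 1) → Fin m) : Ψ s α = 0 := by
  classical
  have hP : (∑ s : Fin d, ∑ α : Fin ((s : ℕ) + 1) → Fin m,
      MvPolynomial.C (Ψ s α) * ∏ t, (MvPolynomial.X (α t) : MvPolynomial (Fin m) ℝ)) = 0 := by
    apply MvPolynomial.funext
    intro u
    simpa using h u
  have hc := congrArg (MvPolynomial.coeff (tupExp α)) hP
  simp only [prod_X_tup, MvPolynomial.coeff_sum, MvPolynomial.coeff_C_mul,
    MvPolynomial.coeff_monomial, MvPolynomial.coeff_zero] at hc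
  rw [Finset.sum_eq_single s] at hc
  · have h2 : ∀ β : Fin ((s : ℕ) + 1) → Fin m,
        Ψ s β * (if tupExp β = tupExp α then (1 : ℝ) else 0) =
        Ψ s α * (if tupExp β = tupExp α then (1 : ℝ) else 0) := by
      intro β
      split_ifs with hb
      · obtain ⟨σ, rfl⟩ := tupExp_perm hb
        rw [hs s σ α]
      · simp
    simp only [h2] at hc
    rw [← Finset.mul_sum] at hc
    rcases mul_eq_zero.1 hc with h0 | h0
    · exact h0
    · exfalso
      have := (Finset.sum_eq_zero_iff_of_nonneg (by intros; split_ifs <;> norm_num)).1 h0 α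
        (Finset.mem_univ _)
      simp at this
  · intro s' _ hne
    apply Finset.sum_eq_zero
    intro β _
    rw [if_neg, mul_zero]
    intro hb
    have := tupExp_size hb
    exact hne (Fin.ext (by omega))
  · simp

lemma exists_decomp_one {I J K : Type*} [Fintype I] [Fintype J]
    (T : I → J → K → ℝ) (h : cpRank T ≤ 1) :
    ∃ (a : I → ℝ) (b : J → ℝ) (c : K → ℝ), ∀ i j k, T i j k = a i * b j * c k := by
  classical
  have hne : {r | ∃ a b c, IsCPDecomp r T a b c}.Nonempty := by
    let e := Fintype.equivFin (I × J)
    refine ⟨Fintype.card (I × J), fun l i => if (e.symm l).1 = i then 1 else 0,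
      fun l j => if (e.symm l).2 = j then 1 else 0,
      fun l k => T (e.symm l).1 (e.symm l).2 k, ?_⟩
    intro i j k
    rw [e.symm.sum_comp (fun p : I × J => (if p.1 = i then (1 : ℝ) else 0) *
      (if p.2 = j then 1 else 0) * T p.1 p.2 k)]
    rw [Fintype.sum_prod_type]
    simp
  have hm := Nat.sInf_mem hne
  change ∃ a b c, IsCPDecomp (cpRank T) T a b c at hm
  obtain ⟨a, b, c, hd⟩ := hm
  generalize cpRank T = r at *
  interval_cases r
  · exact ⟨0, 0, 0, fun i j k => by simpa using hd i j k⟩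
  · exact ⟨a 0, b 0, c 0, fun i j k => by simpa using hd i j k⟩

lemma symT_factor {m s : ℕ} (T : (Fin (s + 1) → Fin m) → ℝ) (hT : SymT T)
    (v : Fin m → ℝ) (j0 : Fin m)
    (h : ∀ α, T α = v (α 0) * T (Function.update α 0 j0)) (α : Fin (s + 1) → Fin m) :
    T α = (∏ t, v (α t)) * T (fun _ => j0) := by
  classical
  have h1 : ∀ t (α : Fin (s + 1) → Fin m), T α = v (α t) * T (Function.update α t j0) := by
    intro t α
    rw [← hT (Equiv.swap 0 t) α, h, ← hT (Equiv.swap 0 t) (Function.update α t j0)]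
    have : Function.update (α ∘ (Equiv.swap 0 t)) 0 j0 =
        Function.update α t j0 ∘ (Equiv.swap 0 t) := by
      ext x
      by_cases hx : x = 0
      · subst hx; simp
      · have : Equiv.swap 0 t x ≠ t := by
          intro hh
          apply hx
          apply (Equiv.swap 0 t).injective
          simpa using hh
        simp [Function.update_of_ne, hx, this]
    rw [this]
    simp
  have h2 : ∀ S : Finset (Fin (s + 1)),
      T α = (∏ t ∈ S, v (α t)) * T (fun t => if t ∈ S then j0 else α t) := by
    intro S
    induction S using Finset.induction_on with
    | empty => simp
    | insert t S ht ih =>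
      rw [ih, h1 t, Finset.prod_insert ht]
      have : Function.update (fun t => if t ∈ S then j0 else α t) t j0 =
          fun x => if x ∈ insert t S then j0 else α x := by
        ext x
        by_cases hx : x = t
        · subst hx; simp
        · simp [Function.update_of_ne, hx]
      rw [this]
      simp only [ht, if_false]
      ring
  simpa using h2 Finset.univ

lemma eval_rankone {m : ℕ} (s : ℕ) (w c : ℝ) (v u : Fin m → ℝ) :
    ∑ α : Fin s → Fin m, (w * c * ∏ t, v (α t)) * ∏ t, u (α t) =
      w * (c * (∑ j, v j * u j) ^ s) := by
  rw [Fintype.sum_pow, ← mul_assoc, Finset.mul_sum]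
  refine Finset.sum_congr rfl fun α _ => ?_
  rw [Finset.prod_mul_distrib]
  ring

/-- the CP rank of the coefficient tensor `Q` of a degree-`d` polynomial map
`f` is at most `1` if and only if `f(u) = w g(v^T u)` for some `w ∈ ℝ^n`, `v ∈ ℝ^m` and a
univariate polynomial `g(t) = c_1 t + ⋯ + c_d t^d`. -/
theorem stmt13 (m n d : ℕ)
    (Φ : (i : Fin n) → (s : Fin d) → (Fin ((s : ℕ) + 1) → Fin m) → ℝ)
    (hsym : ∀ i s, SymT (Φ i s)) :
    cpRank (coeffTensor Φ) ≤ 1 ↔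
      ∃ (w : Fin n → ℝ) (v : Fin m → ℝ) (c : Fin d → ℝ),
        ∀ (u : Fin m → ℝ) (i : Fin n),
          polyEval Φ u i = w i * ∑ s : Fin d, c s * (∑ j, v j * u j) ^ ((s : ℕ) + 1) := by
  constructor
  · intro h
    obtain ⟨a, b, c, hd⟩ := exists_decomp_one _ h
    have hd' : ∀ i (s : Fin d) (α : Fin ((s : ℕ) + 1) → Fin m),
        Φ i s α = a i * b (α 0) * c ⟨s, Fin.tail α⟩ := by
      intro i s α
      have := hd i (α 0) ⟨s, Fin.tail α⟩
      simpa [coeffTensor, Fin.cons_self_tail] using this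
    by_cases hb : ∀ j, b j = 0
    · refine ⟨0, 0, 0, fun u i => ?_⟩
      simp [polyEval, hd', hb]
    · push Not at hb
      obtain ⟨j0, hj0⟩ := hb
      refine ⟨a, fun j => b j / b j0, fun s => b j0 * c ⟨s, fun _ => j0⟩, fun u i => ?_⟩
      unfold polyEval
      rw [Finset.mul_sum]
      refine Finset.sum_congr rfl fun s _ => ?_
      rw [← eval_rankone]
      refine Finset.sum_congr rfl fun α _ => ?_
      congr 1
      rw [symT_factor (Φ i s) (hsym i s) (fun j => b j / b j0) j0 _ α]
      · rw [hd' i s (fun _ => j0)]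
        have : Fin.tail (fun _ : Fin ((s : ℕ) + 1) => j0) = fun _ => j0 := rfl
        rw [this]
        ring
      · intro α
        rw [hd' i s α, hd' i s (Function.update α 0 j0), Fin.tail_update_zero]
        simp only [Function.update_self]
        field_simp
  · rintro ⟨w, v, c, hf⟩
    have key : ∀ i s α, Φ i s α = w i * c s * ∏ t, v (α t) := by
      intro i s α
      have := symT_zero (fun s α => Φ i s α - w i * c s * ∏ t, v (α t)) ?_ ?_ s α
      · exact sub_eq_zero.1 this
      · intro s σ α
        have h1 := hsym i s σ α
        have h2 : ∏ t, v ((α ∘ σ) t) = ∏ t, v (α t) := Equiv.prod_comp σ (fun t => v (α t))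
        simp only [h1, h2]
      · intro u
        have := hf u i
        simp only [sub_mul, Finset.sum_sub_distrib, eval_rankone]
        rw [← Finset.mul_sum, ← this]
        exact sub_self _
    apply Nat.sInf_le
    refine ⟨fun _ => w, fun _ => v, fun _ => zVec d c v, ?_⟩
    intro i j p
    simp only [coeffTensor, zVec, key, Fin.prod_univ_succ, Fin.cons_zero, Fin.cons_succ,
      Finset.univ_unique, Finset.sum_singleton]
    ring
end

section
/- Let f : ℝ^m → ℝ^n be a polynomial map of degree d, let u^{(1)},…,u^{(N)} ∈ ℝ^m be sampling points whose Vandermonde-like matrix A ∈ ℝ^{δ×N} has rank M = C(m+d−1, d−1), and let J ∈ ℝ^{n×m×N} be the Jacobian tensor of f at these points. Then the CP rank of J is at most 1 if and only if there exist w ∈ ℝ^n, v ∈ ℝ^m, and a univariate polynomial g(t) = c_1 t + ⋯ + c_d t^d such that f(u) = w g(v^T u) for all u ∈ ℝ^m. -/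
open scoped BigOperators

lemma cpRank_le_one_iff_aux {n m N : ℕ} (T : Fin n → Fin m → Fin N → ℝ) :
    cpRank T ≤ 1 ↔ ∃ (a : Fin n → ℝ) (b : Fin m → ℝ) (c : Fin N → ℝ),
      ∀ i j k, T i j k = a i * b j * c k := by
  constructor
  · intro h
    have hne : {r | ∃ a b c, IsCPDecomp r T a b c}.Nonempty := by
      refine ⟨Fintype.card (Fin n × Fin m), ?_⟩
      let e := (Fintype.equivFin (Fin n × Fin m)).symm
      refine ⟨fun l i => if (e l).1 = i then 1 else 0, fun l j => if (e l).2 = j then 1 else 0,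
        fun l k => T (e l).1 (e l).2 k, ?_⟩
      intro i j k
      rw [Equiv.sum_comp e (fun q => (if q.1 = i then (1:ℝ) else 0) * (if q.2 = j then 1 else 0) *
        T q.1 q.2 k)]
      rw [Fintype.sum_prod_type]
      simp
    have hmem : ∃ a b c, IsCPDecomp (cpRank T) T a b c := Nat.sInf_mem hne
    generalize cpRank T = r at h hmem
    obtain ⟨a, b, c, hd⟩ := hmem
    interval_cases r
    · exact ⟨0, 0, 0, fun i j k => by simpa using hd i j k⟩
    · exact ⟨a 0, b 0, c 0, fun i j k => by simpa using hd i j k⟩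
  · rintro ⟨a, b, c, h⟩
    exact Nat.sInf_le ⟨fun _ => a, fun _ => b, fun _ => c, fun i j k => by simpa using h i j k⟩

/-- monomial functions indexed by multisets with padding -/
def monoF (m D : ℕ) (σ : Sym (Option (Fin m)) D) : (Fin m → ℝ) → ℝ :=
  fun u => ((σ : Multiset (Option (Fin m))).map (fun o => o.elim 1 u)).prod

/-- polynomial functions of degree at most D -/
def polyV (m D : ℕ) : Submodule ℝ ((Fin m → ℝ) → ℝ) :=
  Submodule.span ℝ (Set.range (monoF m D))

lemma mono_mem_polyV (m D : ℕ) (s : Multiset (Fin m)) (hs : s.card ≤ D) :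
    (fun u : Fin m → ℝ => (s.map u).prod) ∈ polyV m D := by
  apply Submodule.subset_span
  refine ⟨⟨s.map some + Multiset.replicate (D - s.card) none, by simp; omega⟩, ?_⟩
  funext u
  simp [monoF, Function.comp_def]

lemma finprod_mem_polyV (m D : ℕ) {ι : Type*} (S : Finset ι) (α : ι → Fin m) (hs : S.card ≤ D) :
    (fun u : Fin m → ℝ => ∏ t ∈ S, u (α t)) ∈ polyV m D := by
  have := mono_mem_polyV m D (S.val.map α) (by simpa using hs)
  convert this using 2
  rw [Multiset.map_map]
  rfl

lemma vanish (m d N : ℕ) (pts : Fin N → Fin m → ℝ)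
    (hA : (vdm m d N pts).rank = (m + d - 1).choose (d - 1))
    (p : (Fin m → ℝ) → ℝ) (hp : p ∈ polyV m (d - 1)) (h0 : ∀ l, p (pts l) = 0) : p = 0 := by
  classical
  rcases Nat.eq_zero_or_pos d with rfl | hd
  · exfalso
    have := (vdm m 0 N pts).rank_le_card_height
    rw [hA] at this
    simp at this
  have : FiniteDimensional ℝ (polyV m (d - 1)) :=
    FiniteDimensional.span_of_finite ℝ (Set.finite_range _)
  have hV : Module.finrank ℝ (polyV m (d - 1)) ≤ (m + d - 1).choose (d - 1) := by
    refine (finrank_range_le_card (R := ℝ) (monoF m (d - 1))).trans ?_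
    rw [Sym.card_sym_eq_choose]
    apply le_of_eq
    congr 1
    simp
    omega
  let E : ((Fin m → ℝ) → ℝ) →ₗ[ℝ] (Fin N → ℝ) := LinearMap.funLeft ℝ ℝ pts
  let E' := E.domRestrict (polyV m (d - 1))
  have hr : (m + d - 1).choose (d - 1) ≤ Module.finrank ℝ (LinearMap.range E') := by
    rw [← hA, Matrix.rank_eq_finrank_span_row]
    apply Submodule.finrank_mono
    rw [Submodule.span_le]
    rintro _ ⟨q, rfl⟩
    have hm := finprod_mem_polyV m (d - 1) (Finset.univ : Finset (Fin (q.1 : ℕ))) q.2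
      (by simp; have := q.1.2; omega)
    refine ⟨⟨_, (polyV m (d - 1)).smul_mem (((q.1 : ℕ) : ℝ) + 1) hm⟩, ?_⟩
    funext l
    simp [E', E, vdm, LinearMap.funLeft, Matrix.row]
  have hrn := LinearMap.finrank_range_add_finrank_ker E'
  have hk : Module.finrank ℝ (LinearMap.ker E') = 0 := by omega
  have hk' : LinearMap.ker E' = ⊥ := Submodule.finrank_eq_zero.mp hk
  have hin := LinearMap.ker_eq_bot.mp hk'
  have : (⟨p, hp⟩ : polyV m (d - 1)) = 0 := by
    apply hin
    rw [map_zero]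
    funext l
    simpa [E', E, LinearMap.funLeft] using h0 l
  exact congrArg Subtype.val this

lemma polyEval_diff {m n d : ℕ}
    (Φ : (i : Fin n) → (s : Fin d) → (Fin ((s : ℕ) + 1) → Fin m) → ℝ) (i : Fin n) :
    Differentiable ℝ (fun u => polyEval Φ u i) := by
  unfold polyEval
  fun_prop

lemma deriv_mem {m n d : ℕ}
    (Φ : (i : Fin n) → (s : Fin d) → (Fin ((s : ℕ) + 1) → Fin m) → ℝ) (i : Fin n) (j : Fin m) :
    (fun u => fderiv ℝ (fun x => polyEval Φ x i) u (Pi.single j 1)) ∈ polyV m (d - 1) := by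
  classical
  have key : (fun u => fderiv ℝ (fun x => polyEval Φ x i) u (Pi.single j 1)) =
      ∑ s : Fin d, ∑ α : Fin ((s : ℕ) + 1) → Fin m, Φ i s α •
        ∑ t, (Pi.single j (1 : ℝ) : Fin m → ℝ) (α t) •
          (fun u : Fin m → ℝ => ∏ k ∈ Finset.univ.erase t, u (α k)) := by
    funext u
    have h : HasFDerivAt (fun x => polyEval Φ x i)
      (∑ s : Fin d, ∑ α : Fin ((s : ℕ) + 1) → Fin m, Φ i s α •
        ∑ t, (∏ k ∈ Finset.univ.erase t, u (α k)) •
          (ContinuousLinearMap.proj (R := ℝ) (φ := fun _ : Fin m => ℝ) (α t))) u := by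
      unfold polyEval
      refine HasFDerivAt.fun_sum fun s _ => HasFDerivAt.fun_sum fun α _ => ?_
      refine HasFDerivAt.const_mul ?_ _
      exact HasFDerivAt.finsetProd fun t _ => hasFDerivAt_apply (α t) u
    rw [h.fderiv]
    simp [Finset.sum_apply, mul_comm]
  rw [key]
  refine Submodule.sum_mem _ fun s _ => Submodule.sum_mem _ fun α _ => Submodule.smul_mem _ _ <|
    Submodule.sum_mem _ fun t _ => Submodule.smul_mem _ _ ?_
  apply finprod_mem_polyV
  rw [Finset.card_erase_of_mem (Finset.mem_univ _)]
  simp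
  have := s.2
  omega

lemma polyEval_zero {m n d : ℕ}
    (Φ : (i : Fin n) → (s : Fin d) → (Fin ((s : ℕ) + 1) → Fin m) → ℝ) (i : Fin n) :
    polyEval Φ 0 i = 0 := by
  simp [polyEval]

lemma polyEval_smul {m n d : ℕ}
    (Φ : (i : Fin n) → (s : Fin d) → (Fin ((s : ℕ) + 1) → Fin m) → ℝ) (i : Fin n) (t : ℝ)
    (x : Fin m → ℝ) :
    polyEval Φ (t • x) i = ∑ s : Fin d,
      (∑ α : Fin ((s : ℕ) + 1) → Fin m, Φ i s α * ∏ k, x (α k)) * t ^ ((s : ℕ) + 1) := by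
  unfold polyEval
  refine Finset.sum_congr rfl fun s _ => ?_
  rw [Finset.sum_mul]
  refine Finset.sum_congr rfl fun α _ => ?_
  simp [Finset.prod_mul_distrib]
  ring

lemma fderiv_expand {m : ℕ} (L : (Fin m → ℝ) →L[ℝ] ℝ) (y : Fin m → ℝ) :
    L y = ∑ j, y j * L (Pi.single j 1) := by
  classical
  conv_lhs => rw [pi_eq_sum_univ' y]
  rw [map_sum]
  simp

lemma const_line {m : ℕ} (f : (Fin m → ℝ) → ℝ) (hf : Differentiable ℝ f) (q y : Fin m → ℝ)
    (h : ∀ u, fderiv ℝ f u y = 0) : f (q + y) = f q := by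
  have hd : ∀ t : ℝ, HasDerivAt (fun t : ℝ => f (q + t • y)) 0 t := by
    intro t
    have h1 : HasDerivAt (fun t : ℝ => q + t • y) y t := by
      simpa using ((hasDerivAt_id t).smul_const y).const_add q
    have := (hf (q + t • y)).hasFDerivAt.comp_hasDerivAt t h1
    rw [h] at this
    exact this
  have := is_const_of_deriv_eq_zero (fun t => (hd t).differentiableAt) (fun t => (hd t).deriv) 1 0
  simpa using this

/-- if the Vandermonde-like matrix of the sampling points has full rank
`M = C(m+d-1, d-1)`, then the CP rank of the Jacobian tensor `J` is at most `1` if and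
only if `f(u) = w g(v^T u)` for some `w`, `v` and a univariate polynomial
`g(t) = c_1 t + ⋯ + c_d t^d`. -/
theorem stmt14 (m n d N : ℕ)
    (Φ : (i : Fin n) → (s : Fin d) → (Fin ((s : ℕ) + 1) → Fin m) → ℝ)
    (hsym : ∀ i s, SymT (Φ i s))
    (pts : Fin N → Fin m → ℝ)
    (hA : (vdm m d N pts).rank = (m + d - 1).choose (d - 1)) :
    cpRank (jacTensor (polyEval Φ) pts) ≤ 1 ↔
      ∃ (w : Fin n → ℝ) (v : Fin m → ℝ) (c : Fin d → ℝ),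
        ∀ (u : Fin m → ℝ) (i : Fin n),
          polyEval Φ u i = w i * ∑ s : Fin d, c s * (∑ j, v j * u j) ^ ((s : ℕ) + 1) := by
  classical
  rw [cpRank_le_one_iff_aux]
  constructor
  · rintro ⟨a, b, c, hJ⟩
    set P : Fin n → Fin m → (Fin m → ℝ) → ℝ :=
      fun i j u => fderiv ℝ (fun x => polyEval Φ x i) u (Pi.single j 1) with hP
    have hPm : ∀ i j, P i j ∈ polyV m (d - 1) := fun i j => deriv_mem Φ i j
    have hJ' : ∀ i j l, P i j (pts l) = a i * b j * c l := hJ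
    have hh : ∃ h : (Fin m → ℝ) → ℝ, ∀ i j u, P i j u = a i * b j * h u := by
      by_cases hab : ∃ i0 j0, a i0 * b j0 ≠ 0
      · obtain ⟨i0, j0, h0⟩ := hab
        refine ⟨fun u => P i0 j0 u / (a i0 * b j0), fun i j u => ?_⟩
        have := vanish m d N pts hA ((a i0 * b j0) • P i j - (a i * b j) • P i0 j0)
          (Submodule.sub_mem _ (Submodule.smul_mem _ _ (hPm i j))
            (Submodule.smul_mem _ _ (hPm i0 j0)))
          (fun l => by
            simp only [Pi.sub_apply, Pi.smul_apply, smul_eq_mul, hJ']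
            ring)
        have hu := congrFun this u
        simp only [Pi.sub_apply, Pi.smul_apply, smul_eq_mul, Pi.zero_apply] at hu
        rw [← mul_div_assoc, eq_div_iff h0]
        linarith
      · push Not at hab
        refine ⟨0, fun i j u => ?_⟩
        have := vanish m d N pts hA (P i j) (hPm i j) (fun l => by simp [hJ', hab])
        simp [this]
    obtain ⟨h, hh⟩ := hh
    have hfd : ∀ i u y, fderiv ℝ (fun x => polyEval Φ x i) u y =
        a i * h u * ∑ j, b j * y j := by
      intro i u y
      rw [fderiv_expand, Finset.mul_sum]
      refine Finset.sum_congr rfl fun j _ => ?_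
      have := hh i j u
      simp only [hP] at this
      rw [this]
      ring
    by_cases ha : ∃ i0, a i0 ≠ 0
    · obtain ⟨i0, hi0⟩ := ha
      let B : ℝ := ∑ j, b j * b j
      refine ⟨a, b, fun s => (∑ α : Fin ((s : ℕ) + 1) → Fin m,
        Φ i0 s α * ∏ k, (B⁻¹ • b) (α k)) / a i0, fun u i => ?_⟩
      have h1 : polyEval Φ u i0 = polyEval Φ ((∑ j, b j * u j) • (B⁻¹ • b)) i0 := by
        have := const_line (fun x => polyEval Φ x i0) (polyEval_diff Φ i0)
          ((∑ j, b j * u j) • (B⁻¹ • b)) (u - (∑ j, b j * u j) • (B⁻¹ • b)) (fun x => by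
            rw [hfd]
            have : ∑ j, b j * (u - (∑ j, b j * u j) • (B⁻¹ • b)) j = 0 := by
              have e : ∑ j, b j * (u - (∑ j, b j * u j) • (B⁻¹ • b)) j =
                  (∑ j, b j * u j) - (∑ j, b j * u j) * B⁻¹ * B := by
                simp only [B, Pi.sub_apply, Pi.smul_apply, smul_eq_mul, mul_sub,
                  Finset.sum_sub_distrib]
                congr 1
                rw [Finset.mul_sum]
                refine Finset.sum_congr rfl fun j _ => ?_
                ring
              rw [e]
              by_cases hB : B = 0
              · have hb : ∀ j, b j = 0 := by
                  intro j
                  have := (Finset.sum_eq_zero_iff_of_nonneg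
                    (fun j _ => mul_self_nonneg (b j))).mp hB j (Finset.mem_univ j)
                  simpa using this
                simp [hb]
              · field_simp
                ring
            rw [this, mul_zero])
        simpa using this
      have h2 : a i0 * polyEval Φ u i = a i * polyEval Φ u i0 := by
        have := is_const_of_fderiv_eq_zero (𝕜 := ℝ)
          (f := fun x => a i0 * polyEval Φ x i - a i * polyEval Φ x i0)
          (((polyEval_diff Φ i).const_mul _).sub ((polyEval_diff Φ i0).const_mul _))
          (fun x => by
            have := (((polyEval_diff Φ i) x).hasFDerivAt.const_mul (a i0)).sub
              (((polyEval_diff Φ i0) x).hasFDerivAt.const_mul (a i))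
            refine (HasFDerivAt.fderiv this).trans ?_
            ext1 y
            simp [hfd]
            ring) u 0
        simp only [polyEval_zero] at this
        linarith
      rw [h1, polyEval_smul] at h2
      have h3 : polyEval Φ u i = a i * (∑ s : Fin d, (∑ α : Fin ((s : ℕ) + 1) → Fin m,
        Φ i0 s α * ∏ k, (B⁻¹ • b) (α k)) * (∑ j, b j * u j) ^ ((s : ℕ) + 1)) / a i0 := by
        rw [eq_div_iff hi0, ← h2]
        ring
      rw [h3, mul_div_assoc, Finset.sum_div]
      congr 1
      refine Finset.sum_congr rfl fun s _ => ?_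
      ring
    · push Not at ha
      refine ⟨0, 0, 0, fun u i => ?_⟩
      have := const_line (fun x => polyEval Φ x i) (polyEval_diff Φ i) 0 u
        (fun x => by simp [hfd, ha])
      simpa [polyEval_zero] using this
  · rintro ⟨w, v, c, hf⟩
    let L : (Fin m → ℝ) →L[ℝ] ℝ :=
      ∑ j, v j • ContinuousLinearMap.proj (R := ℝ) (φ := fun _ : Fin m => ℝ) j
    have hL : ∀ u, L u = ∑ j, v j * u j := fun u => by simp [L]
    let G : ℝ → ℝ := fun t => ∑ s : Fin d, c s * t ^ ((s : ℕ) + 1)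
    have hG : Differentiable ℝ G := by
      simp only [G]
      fun_prop
    refine ⟨w, v, fun l => deriv G (L (pts l)), fun i j l => ?_⟩
    have he : (fun x => polyEval Φ x i) = fun x => w i * G (L x) := by
      funext x
      rw [hf, hL]
    have hd := ((hG (L (pts l))).hasDerivAt.comp_hasFDerivAt (pts l) L.hasFDerivAt).const_mul (w i)
    unfold jacTensor
    rw [he]
    change HasFDerivAt (fun x => w i * G (L x)) _ _ at hd
    rw [HasFDerivAt.fderiv hd]
    have : L (Pi.single j 1) = v j := by
      rw [hL]; simp [Pi.single_apply]
    simp [this]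
    ring
end

section
/- Let p be a real polynomial in m variables of total degree at most d with zero constant term, and suppose its coefficient matrix factors as Ψ(p) = v y^T for some v ∈ ℝ^m and y ∈ ℝ^δ (i.e., Ψ(p) has rank at most 1). Then there exists a univariate polynomial g(t) = c_1 t + c_2 t^2 + ⋯ + c_d t^d such that p(u) = g(v^T u) for all u ∈ ℝ^m. -/
open scoped BigOperators

theorem aux17 {m n : ℕ} (T : (Fin (n + 1) → Fin m) → ℝ) (hs : SymT T)
    (v : Fin m → ℝ) (y : (Fin n → Fin m) → ℝ)
    (h : ∀ j β, T (Fin.cons j β) = v j * y β) :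
    ∃ c : ℝ, ∀ α, T α = c * ∏ t, v (α t) := by
  by_cases hv : ∀ j, v j = 0
  · refine ⟨0, fun α => ?_⟩
    rw [← Fin.cons_self_tail α, h, hv]
    simp
  push Not at hv
  obtain ⟨k, hk⟩ := hv
  have h0 : ∀ α, T α * v k = v (α 0) * T (Function.update α 0 k) := by
    intro α
    have e : Function.update α 0 k = Fin.cons k (Fin.tail α) := by
      conv_lhs => rw [← Fin.cons_self_tail α]
      rw [Fin.update_cons_zero]
    have e2 : T α = v (α 0) * y (Fin.tail α) := by
      conv_lhs => rw [← Fin.cons_self_tail α]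
      rw [h]
    rw [e, h, e2]
    ring
  have h1 : ∀ t α, T α * v k = v (α t) * T (Function.update α t k) := by
    intro t α
    have a := h0 (α ∘ Equiv.swap 0 t)
    have b := hs (Equiv.swap 0 t) (Function.update α t k)
    rw [Function.update_comp_equiv] at b
    simp only [Equiv.symm_swap, Equiv.swap_apply_right] at b
    rw [hs, b] at a
    simpa using a
  have h2 : ∀ (S : Finset (Fin (n + 1))) (α), T α * v k ^ S.card
      = (∏ t ∈ S, v (α t)) * T (S.piecewise (fun _ => k) α) := by
    intro S α
    induction S using Finset.induction_on with
    | empty => simp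
    | insert a S ha ih =>
      rw [Finset.card_insert_of_notMem ha, Finset.prod_insert ha, pow_succ, ← mul_assoc, ih,
        mul_assoc, h1 a, Finset.piecewise_insert, Finset.piecewise_eq_of_notMem _ _ _ ha]
      ring
  refine ⟨T (fun _ => k) / v k ^ (n + 1), fun α => ?_⟩
  have := h2 Finset.univ α
  simp only [Finset.card_univ, Fintype.card_fin, Finset.piecewise_univ] at this
  field_simp
  linarith

/-- if the coefficient matrix of a degree-`d` polynomial `p` (with zero
constant term, represented by symmetric tensors `Φ^{(s)}`) factors as `Ψ(p) = v y^T`,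
then `p(u) = g(v^T u)` for some univariate polynomial `g(t) = c_1 t + ⋯ + c_d t^d`. -/
theorem stmt17 (m d : ℕ)
    (Φ : (s : Fin d) → (Fin ((s : ℕ) + 1) → Fin m) → ℝ)
    (hsym : ∀ s, SymT (Φ s))
    (v : Fin m → ℝ) (y : DeltaIdx m d → ℝ)
    (hfact : ∀ (j : Fin m) (p : DeltaIdx m d),
      Φ p.1 (Fin.cons j p.2) = v j * y p) :
    ∃ c : Fin d → ℝ, ∀ u : Fin m → ℝ,
      (∑ s : Fin d, ∑ α : Fin ((s : ℕ) + 1) → Fin m, Φ s α * ∏ t, u (α t))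
        = ∑ s : Fin d, c s * (∑ j, v j * u j) ^ ((s : ℕ) + 1) := by
  choose c hc using fun s => aux17 (Φ s) (hsym s) v (fun β => y ⟨s, β⟩)
    (fun j β => hfact j ⟨s, β⟩)
  refine ⟨c, fun u => Finset.sum_congr rfl fun s _ => ?_⟩
  rw [Fintype.sum_pow, Finset.mul_sum]
  refine Finset.sum_congr rfl fun α _ => ?_
  rw [hc, Finset.prod_mul_distrib, mul_assoc]
end

section
/- Let f : ℝ^m → ℝ^n admit a decoupled representation f(u) = Σ_{k=1}^r w_k g_k(v_k^T u) with g_k(t) = c_{k,1} t + ⋯ + c_{k,d} t^d, and for each i and each s ∈ {1,…,d} let Φ_i^{(s)} be the symmetric tensor of order s representing the degree-s homogeneous part of f_i. Then for every s, Φ_i^{(s)} = Σ_{k=1}^r (w_k)_i c_{k,s} · v_k ∘ v_k ∘ ⋯ ∘ v_k (the s-fold outer power of v_k); equivalently, the tensor T^s ∈ ℝ^{n×m×⋯×m} with slices T^s_{i,:,…,:} = Φ_i^{(s)} admits the partially symmetric CP decomposition T^s = Σ_{k=1}^r c_{k,s} · w_k ∘ v_k ∘ ⋯ ∘ v_k.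 -/
open scoped BigOperators

theorem aux_symm_unique {m d : ℕ} (D : (s : Fin d) → (Fin ((s : ℕ) + 1) → Fin m) → ℝ)
    (hsym : ∀ s, SymT (D s))
    (h : ∀ u : Fin m → ℝ, ∑ s : Fin d, ∑ α : Fin ((s : ℕ) + 1) → Fin m,
      D s α * ∏ t, u (α t) = 0) (s : Fin d) (β : Fin ((s : ℕ) + 1) → Fin m) : D s β = 0 := by
  classical
  let e : (k : ℕ) → (Fin k → Fin m) → (Fin m →₀ ℕ) := fun k α => ∑ t, Finsupp.single (α t) 1
  have hdeg : ∀ k (α : Fin k → Fin m), (e k α).degree = k := by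
    intro k α
    simp [e, map_sum]
  have hmul : ∀ k (α : Fin k → Fin m) (x : Fin m),
      e k α x = Fintype.card {t // α t = x} := by
    intro k α x
    simp only [e, Finsupp.finset_sum_apply, Finsupp.single_apply]
    rw [Fintype.card_subtype, Finset.card_filter]
  have hP : (∑ s : Fin d, ∑ α : Fin ((s : ℕ) + 1) → Fin m,
      MvPolynomial.monomial (e _ α) (D s α) : MvPolynomial (Fin m) ℝ) = 0 := by
    apply MvPolynomial.funext
    intro u
    rw [map_zero, ← h u]
    simp only [map_sum]
    refine Finset.sum_congr rfl fun s _ => Finset.sum_congr rfl fun α _ => ?_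
    have : (MvPolynomial.monomial (e _ α) (D s α) : MvPolynomial (Fin m) ℝ)
        = MvPolynomial.C (D s α) * ∏ t, MvPolynomial.X (α t) := by
      simp only [e, MvPolynomial.X]
      rw [← MvPolynomial.monomial_sum_one, MvPolynomial.C_mul_monomial, mul_one]
    rw [this]
    simp [map_prod]
  have hc := congrArg (MvPolynomial.coeff (e _ β)) hP
  simp only [MvPolynomial.coeff_sum, MvPolynomial.coeff_monomial, MvPolynomial.coeff_zero] at hc
  rw [Finset.sum_eq_single s] at hc
  · have h2 : ∀ α : Fin ((s : ℕ) + 1) → Fin m,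
        (if e _ α = e _ β then D s α else 0) = if e _ α = e _ β then D s β else 0 := by
      intro α
      split_ifs with hab
      · have h3 : ∀ x, Nonempty ({t // α t = x} ≃ {t // β t = x}) := by
          intro x
          rw [← Fintype.card_eq, ← hmul, ← hmul, hab]
        have hσ : α = β ∘ (Equiv.ofFiberEquiv fun x => (h3 x).some) := by
          funext t
          exact (Equiv.ofFiberEquiv_map (fun x => (h3 x).some) t).symm
        rw [hσ]
        exact hsym s _ β
      · rfl
    simp only [h2] at hc
    rw [← Finset.sum_filter, Finset.sum_const, nsmul_eq_mul, mul_eq_zero] at hc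
    rcases hc with hc | hc
    · exfalso
      have : (Finset.univ.filter fun α : Fin ((s : ℕ) + 1) → Fin m => e _ α = e _ β) = ∅ := by
        rw [← Finset.card_eq_zero]; exact_mod_cast hc
      have hb : β ∈ (Finset.univ.filter fun α : Fin ((s : ℕ) + 1) → Fin m => e _ α = e _ β) := by
        simp
      rw [this] at hb
      simp at hb
    · exact hc
  · intro s' _ hs'
    refine Finset.sum_eq_zero fun α _ => if_neg fun hab => hs' ?_
    have := congrArg Finsupp.degree hab
    rw [hdeg, hdeg] at this
    exact Fin.ext (by omega)
  · simp

/-- if `f(u) = Σ_k w_k g_k(v_k^T u)` with `g_k(t) = Σ_s c_{k,s} t^s`, then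
the symmetric tensor of the degree-`s` homogeneous part of each `f_i` equals
`Σ_k (w_k)_i c_{k,s} v_k^{∘s}`; equivalently, the stacked tensors `T^s` admit the
partially symmetric CP decompositions `T^s = Σ_k c_{k,s} w_k ∘ v_k ∘ ⋯ ∘ v_k`. -/
theorem stmt18 (m n d r : ℕ)
    (v : Fin r → Fin m → ℝ) (w : Fin r → Fin n → ℝ) (c : Fin r → Fin d → ℝ)
    (Φ : (i : Fin n) → (s : Fin d) → (Fin ((s : ℕ) + 1) → Fin m) → ℝ)
    (hsym : ∀ i s, SymT (Φ i s))
    (hrep : ∀ (u : Fin m → ℝ) (i : Fin n), polyEval Φ u i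
        = ∑ k, w k i * ∑ s : Fin d, c k s * (∑ j, v k j * u j) ^ ((s : ℕ) + 1)) :
    ∀ (i : Fin n) (s : Fin d) (α : Fin ((s : ℕ) + 1) → Fin m),
      Φ i s α = ∑ k, w k i * c k s * ∏ t, v k (α t) := by
  intro i s α
  rw [← sub_eq_zero]
  refine aux_symm_unique (fun s α => Φ i s α - ∑ k, w k i * c k s * ∏ t, v k (α t)) ?_ ?_ s α
  · intro s σ α
    have h1 := hsym i s σ α
    have h2 : ∀ k, ∏ t, v k ((α ∘ σ) t) = ∏ t, v k (α t) := fun k =>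
      Equiv.prod_comp σ (fun t => v k (α t))
    simp only [h1, h2]
  · intro u
    have hu := hrep u i
    unfold polyEval at hu
    simp only [sub_mul, Finset.sum_sub_distrib]
    rw [hu, sub_eq_zero]
    simp only [Finset.mul_sum]
    rw [Finset.sum_comm]
    refine Finset.sum_congr rfl fun s _ => ?_
    simp only [Finset.sum_mul]
    rw [Finset.sum_comm]
    refine Finset.sum_congr rfl fun k _ => ?_
    rw [Fintype.sum_pow, Finset.mul_sum, Finset.mul_sum]
    refine Finset.sum_congr rfl fun α _ => ?_
    rw [Finset.prod_mul_distrib]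
    ring
end
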